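/- arXiv:1906.01776 — 5 statements merged into one kernel-verified Lean document; each statement's English description precedes it below -/
import Mathlib

section
/- Every finite-dimensional irreducible module over the universal Askey–Wilson algebra △_q has dimension at most đ, where đ = d if d is odd and đ = d/2 if d is even. -/
noncomputable section

/-- The generators `A, B, C` of the free algebra on three generators. -/
def awX (𝔽 : Type*) [Field 𝔽] (i : Fin 3) : FreeAlgebra 𝔽 (Fin 3) := FreeAlgebra.ι 𝔽 i

/-- The three elements of the free algebra that are required to be central in the
universal Askey–Wilson algebra:
`A + (qBC − q⁻¹CB)/(q² − q⁻²)`, `B + (qCA − q⁻¹AC)/(q² − q⁻²)`,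
`C + (qAB − q⁻¹BA)/(q² − q⁻²)`. -/
def awCand (𝔽 : Type*) [Field 𝔽] (q : 𝔽) : Fin 3 → FreeAlgebra 𝔽 (Fin 3)
  | 0 => awX 𝔽 0 + (q ^ 2 - q⁻¹ ^ 2)⁻¹ •
      (q • (awX 𝔽 1 * awX 𝔽 2) - q⁻¹ • (awX 𝔽 2 * awX 𝔽 1))
  | 1 => awX 𝔽 1 + (q ^ 2 - q⁻¹ ^ 2)⁻¹ •
      (q • (awX 𝔽 2 * awX 𝔽 0) - q⁻¹ • (awX 𝔽 0 * awX 𝔽 2))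
  | 2 => awX 𝔽 2 + (q ^ 2 - q⁻¹ ^ 2)⁻¹ •
      (q • (awX 𝔽 0 * awX 𝔽 1) - q⁻¹ • (awX 𝔽 1 * awX 𝔽 0))

/-- The defining relations of the universal Askey–Wilson algebra: each of the three
elements above commutes with each generator (i.e. is central). -/
inductive awRel (𝔽 : Type*) [Field 𝔽] (q : 𝔽) :
    FreeAlgebra 𝔽 (Fin 3) → FreeAlgebra 𝔽 (Fin 3) → Prop
  | comm (i j : Fin 3) :
      awRel 𝔽 q (awCand 𝔽 q i * awX 𝔽 j) (awX 𝔽 j * awCand 𝔽 q i)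

/-- The universal Askey–Wilson algebra `△_q`. -/
abbrev UAW (𝔽 : Type*) [Field 𝔽] (q : 𝔽) := RingQuot (awRel 𝔽 q)

/-- The generator `A` of `△_q`. -/
def awA (𝔽 : Type*) [Field 𝔽] (q : 𝔽) : UAW 𝔽 q :=
  RingQuot.mkAlgHom 𝔽 (awRel 𝔽 q) (awX 𝔽 0)

/-- The generator `B` of `△_q`. -/
def awB (𝔽 : Type*) [Field 𝔽] (q : 𝔽) : UAW 𝔽 q :=
  RingQuot.mkAlgHom 𝔽 (awRel 𝔽 q) (awX 𝔽 1)

/-- The generator `C` of `△_q`. -/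
def awC (𝔽 : Type*) [Field 𝔽] (q : 𝔽) : UAW 𝔽 q :=
  RingQuot.mkAlgHom 𝔽 (awRel 𝔽 q) (awX 𝔽 2)

/-- The central element `α` of `△_q`. -/
def awAlpha (𝔽 : Type*) [Field 𝔽] (q : 𝔽) : UAW 𝔽 q :=
  (q + q⁻¹) • RingQuot.mkAlgHom 𝔽 (awRel 𝔽 q) (awCand 𝔽 q 0)

/-- The central element `β` of `△_q`. -/
def awBeta (𝔽 : Type*) [Field 𝔽] (q : 𝔽) : UAW 𝔽 q :=
  (q + q⁻¹) • RingQuot.mkAlgHom 𝔽 (awRel 𝔽 q) (awCand 𝔽 q 1)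

/-- The central element `γ` of `△_q`. -/
def awGamma (𝔽 : Type*) [Field 𝔽] (q : 𝔽) : UAW 𝔽 q :=
  (q + q⁻¹) • RingQuot.mkAlgHom 𝔽 (awRel 𝔽 q) (awCand 𝔽 q 2)

/-- The generalized `B`-eigenspace `V^{(n)}(θ) = {v ∈ V | (B−θ)^n v = 0}`, an
`𝔽`-subspace of a `△_q`-module `V`; `V(θ) = V^{(1)}(θ)`. -/
def awWt (𝔽 : Type*) [Field 𝔽] (q : 𝔽) (V : Type*) [AddCommGroup V] [Module 𝔽 V]
    [Module (UAW 𝔽 q) V] [IsScalarTower 𝔽 (UAW 𝔽 q) V] (n : ℕ) (θ : 𝔽) :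
    Submodule 𝔽 V where
  carrier := {v | ((awB 𝔽 q - algebraMap 𝔽 (UAW 𝔽 q) θ) ^ n) • v = 0}
  add_mem' := by
    intro a b ha hb
    simp only [Set.mem_setOf_eq] at *
    rw [smul_add, ha, hb, add_zero]
  zero_mem' := by simp
  smul_mem' := by
    intro c v hv
    simp only [Set.mem_setOf_eq] at *
    rw [smul_comm, hv, smul_zero]

open Matrix in
/-- A ring surjecting onto `n × n` matrices whose kernel contains that of a map to an algebra of
dimension less than `n ^ 2` cannot exist (Capelli's identity). -/
theorem sq_le_finrank_of_ker_le {R F L E : Type*} [Ring R] [CommRing F] [Nontrivial F] [Field L]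
    [Ring E] [Algebra L E] [Module.Finite L E] {n : ℕ} (φ : R →+* E)
    (ψ : R →+* Matrix (Fin n) (Fin n) F) (hψ : Function.Surjective ψ)
    (hker : ∀ r, φ r = 0 → ψ r = 0) : n ^ 2 ≤ Module.finrank L E := by
  by_contra! hlt
  rcases n with _ | n
  · simp at hlt
  choose u hu using hψ
  let e : Fin ((n + 1) ^ 2) ≃ Fin (n + 1) × Fin (n + 1) :=
    (finCongr (by ring)).trans finProdFinEquiv.symm
  let x : Fin ((n + 1) ^ 2) → R := fun k => u (single (e k).1 (e k).2 1)
  let y : Fin ((n + 1) ^ 2) → R := fun k => u (single 0 (e k).1 1)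
  let z : Fin ((n + 1) ^ 2) → R := fun k => u (single (e k).2 0 1)
  let w : R := ∑ σ : Equiv.Perm (Fin ((n + 1) ^ 2)),
    Equiv.Perm.sign σ • (List.ofFn fun k => y k * x (σ k) * z k).prod
  have h1 : φ w = 0 := by
    let m : MultilinearMap L (fun _ : Fin ((n + 1) ^ 2) => E) E :=
      (MultilinearMap.mkPiAlgebraFin L ((n + 1) ^ 2) E).compLinearMap
        (fun k => LinearMap.mulLeftRight L (φ (y k), φ (z k)))
    have h := AlternatingMap.map_linearDependent (MultilinearMap.alternatization m)
      (fun k => φ (x k)) (fun hli => by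
        have := hli.fintype_card_le_finrank
        simp at this
        omega)
    rw [MultilinearMap.alternatization_apply] at h
    rw [← h, map_sum]
    refine Finset.sum_congr rfl fun σ _ => ?_
    simp [m, Units.smul_def, map_list_prod, List.map_ofFn, Function.comp_def]
  have h2 : ψ w = single 0 0 1 := by
    have hfac : ∀ (σ : Equiv.Perm (Fin ((n + 1) ^ 2))) (k : Fin ((n + 1) ^ 2)),
        ψ (y k * x (σ k) * z k) = if σ k = k then single 0 0 1 else 0 := by
      intro σ k
      simp only [map_mul, x, y, z, hu]
      split_ifs with h
      · simp [h]
      · by_cases h1 : (e k).1 = (e (σ k)).1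
        · have h2 : (e (σ k)).2 ≠ (e k).2 := fun h2 =>
            h (e.injective (Prod.ext h1.symm h2))
          rw [h1, single_mul_single_same, single_mul_single_of_ne _ _ _ _ h2]
        · rw [single_mul_single_of_ne _ _ _ _ h1, zero_mul]
    have hne : (n + 1) ^ 2 ≠ 0 := by positivity
    simp only [w, map_sum]
    rw [Finset.sum_eq_single 1]
    · rw [Equiv.Perm.sign_one, one_smul, map_list_prod, List.map_ofFn]
      have : (ψ ∘ fun k => y k * x ((1 : Equiv.Perm (Fin ((n + 1) ^ 2))) k) * z k) = fun _ => single 0 0 1 := by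
        funext k
        simp only [Function.comp_apply]
        rw [hfac]
        simp
      rw [this, List.ofFn_const, List.prod_replicate]
      have hid : IsIdempotentElem (single 0 0 1 : Matrix (Fin (n + 1)) (Fin (n + 1)) F) := by
        simp [IsIdempotentElem]
      exact hid.pow_eq hne
    · intro σ _ hσ
      obtain ⟨k, hk⟩ : ∃ k, σ k ≠ k := by
        by_contra! h
        exact hσ (Equiv.ext h)
      rw [Units.smul_def, map_zsmul, map_list_prod, List.map_ofFn,
        List.prod_eq_zero, smul_zero]
      rw [List.mem_ofFn]
      exact ⟨k, by simp only [Function.comp_apply]; rw [hfac, if_neg hk]⟩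
    · simp
  have h3 := hker w h1
  rw [h2] at h3
  have := congrFun (congrFun h3 0) 0
  simp at this

/-- Schur's lemma over an algebraically closed field. -/
theorem exists_forall_eq_smul_of_isSimpleModule {F R V : Type*} [Field F] [IsAlgClosed F] [Ring R]
    [Algebra F R] [AddCommGroup V] [Module F V] [Module R V] [IsScalarTower F R V]
    [FiniteDimensional F V] [IsSimpleModule R V] (g : Module.End R V) :
    ∃ c : F, ∀ v, g v = c • v := by
  have : Nontrivial V := IsSimpleModule.nontrivial R V
  obtain ⟨c, hc⟩ := Module.End.exists_eigenvalue (g.restrictScalars F : Module.End F V)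
  obtain ⟨v, hv, hv0⟩ := hc.exists_hasEigenvector
  rw [Module.End.mem_eigenspace_iff] at hv
  have hv' : g v = c • v := hv
  refine ⟨c, fun w => ?_⟩
  rcases LinearMap.bijective_or_eq_zero (g - algebraMap F (Module.End R V) c) with h | h
  · exact absurd (h.1 (a₁ := v) (a₂ := 0) (by simp [hv'])) hv0
  · have := congrArg (fun f => f w) h
    simpa [sub_eq_zero] using this

/-- Burnside's theorem: the representation map of a finite-dimensional simple module over an
algebra over an algebraically closed field is surjective. -/
theorem lsmul_surjective_of_isSimpleModule {F R V : Type*} [Field F] [IsAlgClosed F] [Ring R]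
    [Algebra F R] [AddCommGroup V] [Module F V] [Module R V] [IsScalarTower F R V]
    [FiniteDimensional F V] [IsSimpleModule R V] :
    Function.Surjective (Algebra.lsmul F F V : R →ₐ[F] Module.End F V) := by
  intro f
  let f' : Module.End (Module.End R V) V :=
    { f with
      map_smul' := fun g v => by
        obtain ⟨c, hc⟩ := exists_forall_eq_smul_of_isSimpleModule (F := F) g
        simp [hc] }
  classical
  let b := Module.finBasis F V
  obtain ⟨r, hr⟩ := jacobson_density (R := R) f' (Finset.univ.image b)
  refine ⟨r, b.ext fun i => ?_⟩
  exact (hr (b i) (by simp)).symm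

/-- Elements `x`, `y` that `q`-commute up to `r`, where `x, y, r ∈ M`, have powers that do so up to
lower filtration degree. -/
theorem mul_pow_sub_mem_pow {F P : Type*} [Field F] [Ring P] [Algebra F P] {M : Submodule F P}
    {x y : P} {c : F} (hy : y ∈ M) (h : x * y - c • (y * x) ∈ M) (j : ℕ) :
    x * y ^ j - c ^ j • (y ^ j * x) ∈ M ^ j := by
  induction j with
  | zero => simp
  | succ j ih =>
    have h1 := Submodule.mul_mem_mul ih hy
    have h2 := Submodule.mul_mem_mul (Submodule.pow_mem_pow M hy j) h
    rw [← pow_succ] at h1 h2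
    have := add_mem h1 ((M ^ (j + 1)).smul_mem (c ^ j) h2)
    convert this using 1
    simp only [sub_mul, mul_sub, smul_sub, smul_mul_assoc, mul_smul_comm, smul_smul, pow_succ,
      mul_assoc]
    abel

/-- If `a, b, c` commute up to scalars and lower filtration degree, and `b * a * c` has degree at
most two, then the filtration pieces are spanned by the monomials `b ^ j * a ^ i * c ^ k` with
`j * i * k = 0`. -/
theorem pow_le_span_monomials {F P : Type*} [Field F] [Ring P] [Algebra F P] {a b c : P}
    {M : Submodule F P} (hM : M = Submodule.span F {1, a, b, c}) {r s t : F} (ht : t ≠ 0)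
    (hab : a * b - r • (b * a) ∈ M) (hcb : c * b - s • (b * c) ∈ M)
    (hca : c * a - t • (a * c) ∈ M) (hbac : b * a * c ∈ M ^ 2) (n : ℕ) :
    M ^ n ≤ Submodule.span F
      {p | ∃ j i k : ℕ, j + i + k ≤ n ∧ j * i * k = 0 ∧ p = b ^ j * a ^ i * c ^ k} := by
  have h1 : (1 : P) ∈ M := hM ▸ Submodule.subset_span (by simp)
  have ha : a ∈ M := hM ▸ Submodule.subset_span (by simp)
  have hb : b ∈ M := hM ▸ Submodule.subset_span (by simp)
  have hc : c ∈ M := hM ▸ Submodule.subset_span (by simp)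
  have mono : ∀ {m n : ℕ}, m ≤ n → M ^ m ≤ M ^ n := fun h =>
    pow_le_pow_right' (Submodule.one_le.mpr h1) h
  have mulmem : ∀ {m n l : ℕ} {x y : P}, x ∈ M ^ m → y ∈ M ^ n → m + n ≤ l → x * y ∈ M ^ l :=
    fun hx hy h => mono h (pow_add M _ _ ▸ Submodule.mul_mem_mul hx hy)
  have apow := Submodule.pow_mem_pow M ha
  have bpow := Submodule.pow_mem_pow M hb
  have cpow := Submodule.pow_mem_pow M hc
  have reduce : ∀ j i k : ℕ, b ^ (j + 1) * a ^ (i + 1) * c ^ (k + 1) ∈ M ^ (j + i + k + 2) := by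
    intro j i k
    have h2 : b ^ j * (b * a * c) * (a ^ i * c ^ k) ∈ M ^ (j + i + k + 2) :=
      mulmem (mulmem (bpow j) hbac le_rfl) (mulmem (apow i) (cpow k) le_rfl) (by omega)
    have h3 : b ^ j * (b * a) * ((c * a ^ i - t ^ i • (a ^ i * c)) * c ^ k) ∈ M ^ (j + i + k + 2) :=
      mulmem (mulmem (bpow j) (mulmem (m := 1) (n := 1) (by simpa) (by simpa) le_rfl) le_rfl)
        (mulmem (mul_pow_sub_mem_pow ha hca i) (cpow k) le_rfl) (by omega)
    have h4 := (M ^ (j + i + k + 2)).smul_mem (t ^ i)⁻¹ (sub_mem h2 h3)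
    convert h4 using 1
    simp only [sub_mul, mul_sub, smul_mul_assoc, mul_smul_comm, smul_smul, mul_assoc,
      inv_mul_cancel₀ (pow_ne_zero i ht), one_smul, sub_sub_cancel, pow_succ, pow_succ' a,
      pow_succ' c]
  induction n with
  | zero =>
    rw [pow_zero, Submodule.one_le]
    exact Submodule.subset_span ⟨0, 0, 0, by simp⟩
  | succ n ih =>
    set W := Submodule.span F
      {p | ∃ j i k : ℕ, j + i + k ≤ n + 1 ∧ j * i * k = 0 ∧ p = b ^ j * a ^ i * c ^ k} with hW
    have hWn : M ^ n ≤ W := ih.trans (Submodule.span_mono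
      fun p ⟨j, i, k, h, h', hp⟩ => ⟨j, i, k, by omega, h', hp⟩)
    have mon : ∀ j i k : ℕ, j + i + k ≤ n + 1 → b ^ j * a ^ i * c ^ k ∈ W := by
      intro j i k h
      by_cases h0 : j * i * k = 0
      · exact Submodule.subset_span ⟨j, i, k, h, h0, rfl⟩
      · obtain ⟨⟨hj, hi⟩, hk⟩ : (j ≠ 0 ∧ i ≠ 0) ∧ k ≠ 0 := by simpa [not_or] using h0
        obtain ⟨j, rfl⟩ := Nat.exists_eq_succ_of_ne_zero hj
        obtain ⟨i, rfl⟩ := Nat.exists_eq_succ_of_ne_zero hi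
        obtain ⟨k, rfl⟩ := Nat.exists_eq_succ_of_ne_zero hk
        exact hWn (mono (by omega) (reduce j i k))
    rw [pow_succ']
    refine (mul_le_mul_right ih _).trans ?_
    rw [hM, Submodule.span_mul_span, Submodule.span_le]
    rintro _ ⟨x, hx, _, ⟨j, i, k, h, -, rfl⟩, rfl⟩
    simp only [Set.mem_insert_iff, Set.mem_singleton_iff] at hx
    change x * (b ^ j * a ^ i * c ^ k) ∈ W
    rcases hx with rfl | rfl | rfl | rfl
    · rw [one_mul]
      exact mon j i k (by omega)
    · have h2 : (x * b ^ j - r ^ j • (b ^ j * x)) * (x ^ i * c ^ k) ∈ W := hWn <|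
        mulmem (mul_pow_sub_mem_pow hb hab j) (mulmem (apow i) (cpow k) le_rfl) (by omega)
      convert add_mem h2 (W.smul_mem (r ^ j) (mon j (i + 1) k (by omega))) using 1
      simp only [sub_mul, smul_mul_assoc, mul_assoc, pow_succ' x]
      abel
    · convert mon (j + 1) i k (by omega) using 1
      simp only [pow_succ' x, mul_assoc]
    · have h2 : (x * b ^ j - s ^ j • (b ^ j * x)) * (a ^ i * x ^ k) ∈ W := hWn <|
        mulmem (mul_pow_sub_mem_pow hb hcb j) (mulmem (apow i) (cpow k) le_rfl) (by omega)
      have h3 : b ^ j * ((x * a ^ i - t ^ i • (a ^ i * x)) * x ^ k) ∈ W := hWn <|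
        mulmem (bpow j) (mulmem (mul_pow_sub_mem_pow ha hca i) (cpow k) le_rfl) (by omega)
      convert add_mem h2 (W.smul_mem (s ^ j)
        (add_mem h3 (W.smul_mem (t ^ i) (mon j i (k + 1) (by omega))))) using 1
      simp only [sub_mul, mul_sub, smul_sub, smul_add, smul_mul_assoc, mul_smul_comm, mul_assoc,
        pow_succ' x]
      abel

/-- Under the hypotheses of `pow_le_span_monomials`, the monomials `b ^ j * a ^ i * c ^ k` with
`j * i * k = 0` span the subalgebra generated by `a, b, c`. -/
theorem adjoin_le_span_monomials {F P : Type*} [Field F] [Ring P] [Algebra F P] {a b c : P}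
    {M : Submodule F P} (hM : M = Submodule.span F {1, a, b, c}) {r s t : F} (ht : t ≠ 0)
    (hab : a * b - r • (b * a) ∈ M) (hcb : c * b - s • (b * c) ∈ M)
    (hca : c * a - t • (a * c) ∈ M) (hbac : b * a * c ∈ M ^ 2) :
    Subalgebra.toSubmodule (Algebra.adjoin F {a, b, c}) ≤ Submodule.span F
      {p | ∃ j i k : ℕ, j * i * k = 0 ∧ p = b ^ j * a ^ i * c ^ k} := by
  intro x hx
  obtain ⟨n, hn⟩ : ∃ n, x ∈ M ^ n := by
    have h1 : (1 : P) ∈ M := hM ▸ Submodule.subset_span (by simp)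
    induction hx using Algebra.adjoin_induction with
    | mem x hx =>
      refine ⟨1, ?_⟩
      rw [pow_one, hM]
      exact Submodule.subset_span (Set.mem_insert_of_mem _ hx)
    | algebraMap r => exact ⟨0, by rw [pow_zero]; exact Submodule.algebraMap_mem r⟩
    | add x y _ _ hx hy =>
      obtain ⟨m, hm⟩ := hx
      obtain ⟨n, hn⟩ := hy
      exact ⟨max m n, add_mem (pow_le_pow_right' (Submodule.one_le.mpr h1) (le_max_left m n) hm)
        (pow_le_pow_right' (Submodule.one_le.mpr h1) (le_max_right m n) hn)⟩
    | mul x y _ _ hx hy =>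
      obtain ⟨m, hm⟩ := hx
      obtain ⟨n, hn⟩ := hy
      exact ⟨m + n, pow_add M m n ▸ Submodule.mul_mem_mul hm hn⟩
  refine Submodule.span_mono ?_ (pow_le_span_monomials hM ht hab hcb hca hbac n hn)
  rintro p ⟨j, i, k, -, h, hp⟩
  exact ⟨j, i, k, h, hp⟩

/-- The middle coefficient of `A` in the generic representation. -/
def awPsi {K : Type*} [Field K] (q α γ x : K) : K :=
  (q + q⁻¹) * ((q + q⁻¹) * α - (x + x⁻¹) * γ) / ((q + q⁻¹) ^ 2 - (x + x⁻¹) ^ 2)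

/-- The middle coefficient of `C` in the generic representation. -/
def awChi {K : Type*} [Field K] (q α γ x : K) : K :=
  γ - (x + x⁻¹) * awPsi q α γ x / (q + q⁻¹)

/-- The part of the constant term of the Casimir relation not involving `awPhi`. -/
def awR {K : Type*} [Field K] (q α β γ ω x : K) : K :=
  ω - (q * (x + x⁻¹) * awPsi q α γ x * awChi q α γ x + q ^ 2 * awPsi q α γ x ^ 2
    + q⁻¹ ^ 2 * (x + x⁻¹) ^ 2 + q ^ 2 * awChi q α γ x ^ 2
    - q * (q + q⁻¹) * α * awPsi q α γ x - q⁻¹ * (q + q⁻¹) * β * (x + x⁻¹)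
    - q * (q + q⁻¹) * γ * awChi q α γ x)

/-- The part of the constant term of the relation for `β` not involving `awPhi`. -/
def awS {K : Type*} [Field K] (q α β γ x : K) : K :=
  (q ^ 2 - q⁻¹ ^ 2) * (β - (x + x⁻¹)) - (q - q⁻¹) * awPsi q α γ x * awChi q α γ x

/-- The lowering coefficient of `A` in the generic representation. -/
def awPhi {K : Type*} [Field K] (q α β γ ω x : K) : K :=
  (awR q α β γ ω x + x⁻¹ * awS q α β γ x) / ((q⁻¹ ^ 2 * x - q ^ 2 * x⁻¹) * (x⁻¹ - x))

theorem awPsi_eq {K : Type*} [Field K] {q α γ x : K} (hq : q ≠ 0) (hx : x ≠ 0) :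
    awPsi q α γ x = - (x * ((q ^ 2 + 1) * ((q ^ 2 + 1) * x * α - q * (x ^ 2 + 1) * γ))) / 
      ((q ^ 2 * x ^ 2 - 1) * (x ^ 2 - q ^ 2)) := by
  have : (q + q⁻¹) ^ 2 - (x + x⁻¹) ^ 2 =
     - ((q ^ 2 * x ^ 2 - 1) * (x ^ 2 - q ^ 2)) / (q ^ 2 * x ^ 2) := by
    field_simp
    ring
  rw [awPsi, this]
  by_cases h : (q ^ 2 * x ^ 2 - 1) * (x ^ 2 - q ^ 2) = 0
  · simp [h]
  · field_simp

theorem awPsi_shift {K : Type*} [Field K] {q α γ x : K} (hq : q ≠ 0) (hx : x ≠ 0) :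
    awPsi q α γ (q ^ 2 * x) =
      - (q ^ 2 * x * ((q ^ 2 + 1) * ((q ^ 2 + 1) * q * x * α - (q ^ 4 * x ^ 2 + 1) * γ))) /
        (q * ((q ^ 6 * x ^ 2 - 1) * (q ^ 2 * x ^ 2 - 1))) := by
  have : (q ^ 2 * (q ^ 2 * x) ^ 2 - 1) * ((q ^ 2 * x) ^ 2 - q ^ 2) =
      q ^ 2 * ((q ^ 6 * x ^ 2 - 1) * (q ^ 2 * x ^ 2 - 1)) := by ring
  rw [awPsi_eq hq (by positivity), this]
  field_simp

theorem awPsi_inv {K : Type*} [Field K] (q α γ x : K) : awPsi q α γ x⁻¹ = awPsi q α γ x := by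
  simp [awPsi, add_comm]

theorem awChi_inv {K : Type*} [Field K] (q α γ x : K) : awChi q α γ x⁻¹ = awChi q α γ x := by
  simp [awChi, awPsi_inv, add_comm]

theorem sub_sq_ne_zero {K : Type*} [Field K] {q x : K} (hq : q ≠ 0)
    (hgen : ∀ n : ℤ, q ^ n * x ^ 2 ≠ 1) : x ^ 2 - q ^ 2 ≠ 0 := by
  intro h
  refine hgen (-2) ?_
  rw [sub_eq_zero.mp h, zpow_neg]
  exact_mod_cast inv_mul_cancel₀ (pow_ne_zero 2 hq)

theorem zpow_mul_inv_sq_ne_one {K : Type*} [Field K] {q x : K}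
    (hgen : ∀ n : ℤ, q ^ n * x ^ 2 ≠ 1) (n : ℤ) : q ^ n * x⁻¹ ^ 2 ≠ 1 := by
  intro h
  apply hgen (-n)
  rw [← inv_inj, mul_inv, inv_one, ← inv_pow, zpow_neg, inv_inv, h]

/-- The constant term of the relation for `α`. -/
theorem awPsi_mul {K : Type*} [Field K] {q α γ x : K} (hq : q ≠ 0) (hx : x ≠ 0)
    (hp : q ^ 2 + 1 ≠ 0) (hgen : ∀ n : ℤ, q ^ n * x ^ 2 ≠ 1) :
    (q - q⁻¹) * (x + x⁻¹) * awChi q α γ x = (q ^ 2 - q⁻¹ ^ 2) * (α - awPsi q α γ x) := by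
  have h1 : q ^ 2 * x ^ 2 - 1 ≠ 0 := sub_ne_zero.mpr (by exact_mod_cast hgen 2)
  have h2 : x ^ 2 - q ^ 2 ≠ 0 := sub_sq_ne_zero hq hgen
  have e2 : q + q⁻¹ = (q ^ 2 + 1) / q := by field_simp
  simp only [awChi, awPsi_eq hq hx, e2]
  field_simp
  ring

/-- The coefficient of the raising operator in the relation for `β`. -/
theorem awPsi_awChi_rel {K : Type*} [Field K] {q α γ x : K} (hq : q ≠ 0) (hx : x ≠ 0)
    (hp : q ^ 2 + 1 ≠ 0) (hgen : ∀ n : ℤ, q ^ n * x ^ 2 ≠ 1) :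
    q * (awChi q α γ x - q * x * awPsi q α γ (q ^ 2 * x)) -
      q⁻¹ * (awChi q α γ (q ^ 2 * x) - q * x * awPsi q α γ x) = 0 := by
  have h1 : q ^ 2 * x ^ 2 - 1 ≠ 0 := sub_ne_zero.mpr (by exact_mod_cast hgen 2)
  have h2 : x ^ 2 - q ^ 2 ≠ 0 := sub_sq_ne_zero hq hgen
  have h4 : q ^ 6 * x ^ 2 - 1 ≠ 0 := sub_ne_zero.mpr (by exact_mod_cast hgen 6)
  have e2 : q + q⁻¹ = (q ^ 2 + 1) / q := by field_simp
  simp only [awChi, awPsi_shift hq hx, awPsi_eq hq hx, e2]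
  field_simp
  ring

/-- The coefficient of the raising operator in the Casimir relation. -/
theorem awPsi_awChi_casimir {K : Type*} [Field K] {q α γ x : K} (hq : q ≠ 0) (hx : x ≠ 0)
    (hp : q ^ 2 + 1 ≠ 0) (hgen : ∀ n : ℤ, q ^ n * x ^ 2 ≠ 1) :
    q * ((q ^ 2 * x + (q ^ 2 * x)⁻¹) * awChi q α γ (q ^ 2 * x)
        - q * x * (x + x⁻¹) * awPsi q α γ x)
      + q ^ 2 * (awPsi q α γ (q ^ 2 * x) + awPsi q α γ x)
      - q ^ 3 * x * (awChi q α γ (q ^ 2 * x) + awChi q α γ x)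
      - q * (q + q⁻¹) * α + q ^ 2 * (q + q⁻¹) * γ * x = 0 := by
  have h1 : q ^ 2 * x ^ 2 - 1 ≠ 0 := sub_ne_zero.mpr (by exact_mod_cast hgen 2)
  have h2 : x ^ 2 - q ^ 2 ≠ 0 := sub_sq_ne_zero hq hgen
  have h4 : q ^ 6 * x ^ 2 - 1 ≠ 0 := sub_ne_zero.mpr (by exact_mod_cast hgen 6)
  have e2 : q + q⁻¹ = (q ^ 2 + 1) / q := by field_simp
  simp only [awChi, awPsi_shift hq hx, awPsi_eq hq hx, e2]
  field_simp
  ring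

theorem awPhi_shift {K : Type*} [Field K] {q α β γ ω x : K} (hq : q ≠ 0) (hx : x ≠ 0)
    (hp : q ^ 2 + 1 ≠ 0) (hgen : ∀ n : ℤ, q ^ n * x ^ 2 ≠ 1) :
    awPhi q α β γ ω (q ^ 2 * x) = (awR q α β γ ω x + x * awS q α β γ x) /
      ((q ^ 2 * x - q⁻¹ ^ 2 * x⁻¹) * (x⁻¹ - x)) := by
  have e1 : (q⁻¹ ^ 2 * (q ^ 2 * x) - q ^ 2 * (q ^ 2 * x)⁻¹) * ((q ^ 2 * x)⁻¹ - q ^ 2 * x) 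
    = (q ^ 2 * x - q⁻¹ ^ 2 * x⁻¹) * (x⁻¹ - x) := by
    field_simp
    ring
  rw [awPhi, e1]
  congr 1
  have h1 : q ^ 2 * x ^ 2 - 1 ≠ 0 := sub_ne_zero.mpr (by exact_mod_cast hgen 2)
  have h2 : x ^ 2 - q ^ 2 ≠ 0 := sub_sq_ne_zero hq hgen
  have h4 : q ^ 6 * x ^ 2 - 1 ≠ 0 := sub_ne_zero.mpr (by exact_mod_cast hgen 6)
  have e2 : q + q⁻¹ = (q ^ 2 + 1) / q := by field_simp
  simp only [awR, awS, awChi, awPsi_shift hq hx, awPsi_eq hq hx, e2]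
  field_simp
  ring

/-- The constant term of the relation for `β`. -/
theorem awPhi_rel {K : Type*} [Field K] {q α β γ ω x : K} (hq : q ≠ 0) (hx : x ≠ 0)
    (hp : q ^ 2 + 1 ≠ 0) (hgen : ∀ n : ℤ, q ^ n * x ^ 2 ≠ 1) :
    (q⁻¹ ^ 2 * x - q ^ 2 * x⁻¹) * awPhi q α β γ ω x
      - (q ^ 2 * x - q⁻¹ ^ 2 * x⁻¹) * awPhi q α β γ ω (q ^ 2 * x) = awS q α β γ x := by
  have h0 : x ^ 2 - 1 ≠ 0 := sub_ne_zero.mpr (by simpa using hgen 0)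
  have h1 : q ^ 4 * x ^ 2 - 1 ≠ 0 := sub_ne_zero.mpr (by exact_mod_cast hgen 4)
  have h2 : x ^ 2 - q ^ 4 ≠ 0 := by
    have := sub_sq_ne_zero (q := q ^ 2) (x := x) (by positivity)
      (fun n => by rw [← zpow_natCast, ← zpow_mul]; exact hgen _)
    rwa [← pow_mul] at this
  have e0 : x⁻¹ - x = - (x ^ 2 - 1) / x := by field_simp; ring
  have e1 : q ^ 2 * x - q⁻¹ ^ 2 * x⁻¹ ≠ 0 := by
    rw [show q ^ 2 * x - q⁻¹ ^ 2 * x⁻¹ = (q ^ 4 * x ^ 2 - 1) / (q ^ 2 * x) by field_simp]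
    positivity
  have e2 : q⁻¹ ^ 2 * x - q ^ 2 * x⁻¹ ≠ 0 := by
    rw [show q⁻¹ ^ 2 * x - q ^ 2 * x⁻¹ = (x ^ 2 - q ^ 4) / (q ^ 2 * x) by field_simp]
    positivity
  rw [awPhi_shift hq hx hp hgen, awPhi, ← mul_div_assoc, ← mul_div_assoc,
    mul_div_mul_left _ _ e1, mul_div_mul_left _ _ e2, e0]
  field_simp
  ring

/-- The constant term of the Casimir relation. -/
theorem awPhi_casimir {K : Type*} [Field K] {q α β γ ω x : K} (hq : q ≠ 0) (hx : x ≠ 0)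
    (hp : q ^ 2 + 1 ≠ 0) (hgen : ∀ n : ℤ, q ^ n * x ^ 2 ≠ 1) :
    (q ^ 2 - q⁻¹ ^ 2 * x⁻¹ ^ 2) * awPhi q α β γ ω (q ^ 2 * x)
      + (q ^ 2 - q⁻¹ ^ 2 * x ^ 2) * awPhi q α β γ ω x = awR q α β γ ω x := by
  have h0 : x ^ 2 - 1 ≠ 0 := sub_ne_zero.mpr (by simpa using hgen 0)
  have h1 : q ^ 4 * x ^ 2 - 1 ≠ 0 := sub_ne_zero.mpr (by exact_mod_cast hgen 4)
  have h2 : x ^ 2 - q ^ 4 ≠ 0 := by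
    have := sub_sq_ne_zero (q := q ^ 2) (x := x) (by positivity)
      (fun n => by rw [← zpow_natCast, ← zpow_mul]; exact hgen _)
    rwa [← pow_mul] at this
  have e0 : x⁻¹ - x = - (x ^ 2 - 1) / x := by field_simp; ring
  have e1 : q ^ 2 * x - q⁻¹ ^ 2 * x⁻¹ = (q ^ 4 * x ^ 2 - 1) / (q ^ 2 * x) := by field_simp
  have e2 : q⁻¹ ^ 2 * x - q ^ 2 * x⁻¹ = (x ^ 2 - q ^ 4) / (q ^ 2 * x) := by field_simp
  rw [awPhi_shift hq hx hp hgen, awPhi, e0, e1, e2]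
  field_simp
  ring

namespace HahnSeries

variable {F R : Type*} [Field F] [Field R] [Algebra F R]

/-- Scalars act on Laurent series coefficientwise. -/
instance (priority := 2000) laurentAlgebra : Algebra F (HahnSeries ℤ R) :=
  HahnSeries.instAlgebra

/-- The automorphism `∑ aₙ tⁿ ↦ ∑ cⁿ σ(aₙ) tⁿ` of a Laurent series field. -/
def twist (σ : R ≃ₐ[F] R) (c : Fˣ) : HahnSeries ℤ R ≃ₐ[F] HahnSeries ℤ R where
  toFun f := ⟨fun n => (c : F) ^ n • σ (f.coeff n), f.isPWO_support.mono fun n hn => by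
    contrapose! hn
    simp_all⟩
  invFun f := ⟨fun n => (c : F)⁻¹ ^ n • σ.symm (f.coeff n), f.isPWO_support.mono fun n hn => by
    contrapose! hn
    simp_all⟩
  left_inv f := by
    ext n
    simp [smul_smul, inv_mul_cancel₀ (zpow_ne_zero n c.ne_zero)]
  right_inv f := by
    ext n
    simp [smul_smul, mul_inv_cancel₀ (zpow_ne_zero n c.ne_zero)]
  map_add' f g := by
    ext n
    simp
  map_mul' f g := by
    ext n
    simp only [coeff_mul, map_sum, map_mul, Finset.smul_sum]
    refine Finset.sum_congr ?_ fun ij hij => ?_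
    · ext ij
      simp [zpow_ne_zero _ c.ne_zero]
    · obtain ⟨-, -, rfl⟩ := Finset.mem_antidiagonal.mp hij
      rw [zpow_add₀ c.ne_zero, smul_mul_smul_comm]
  commutes' a := by
    rw [HahnSeries.algebraMap_apply]
    ext n
    by_cases hn : n = 0
    · simp [hn]
    · simp [C_apply, coeff_single_of_ne hn]

@[simp]
theorem twist_coeff (σ : R ≃ₐ[F] R) (c : Fˣ) (f : HahnSeries ℤ R) (n : ℤ) :
    (twist σ c f).coeff n = (c : F) ^ n • σ (f.coeff n) := rfl

@[simp]
theorem twist_symm_coeff (σ : R ≃ₐ[F] R) (c : Fˣ) (f : HahnSeries ℤ R) (n : ℤ) :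
    ((twist σ c).symm f).coeff n = (c : F)⁻¹ ^ n • σ.symm (f.coeff n) := rfl

theorem twist_pow (σ : R ≃ₐ[F] R) (c : Fˣ) (m : ℕ) : twist σ c ^ m = twist (σ ^ m) (c ^ m) := by
  induction m with
  | zero =>
    ext f n
    simp
  | succ m ih =>
    ext f n
    simp only [pow_succ', ih, AlgEquiv.mul_apply, twist_coeff, Units.val_mul, mul_zpow, mul_smul,
      map_smul]

theorem twist_single (σ : R ≃ₐ[F] R) (c : Fˣ) (n : ℤ) (r : R) :
    twist σ c (single n r) = single n ((c : F) ^ n • σ r) := by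
  ext m
  rw [twist_coeff]
  by_cases h : m = n
  · simp [h]
  · simp [coeff_single_of_ne h]

end HahnSeries

section Generic

open HahnSeries

variable (F : Type*) [Field F]

/-- The iterated Laurent series field `F((x))((t))`. -/
abbrev GenericField := HahnSeries ℤ (HahnSeries ℤ F)

/-- The variable `x` of `F((x))((t))`. -/
def genericX : GenericField F := C (single 1 1)

/-- The variable `t` of `F((x))((t))`. -/
def genericT : GenericField F := single 1 1

variable {F}

/-- The automorphism of `F((x))((t))` fixing `t` and mapping `x` to `c x`. -/
def genericShift (c : Fˣ) : GenericField F ≃ₐ[F] GenericField F :=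
  twist (twist AlgEquiv.refl c) 1

theorem genericShift_genericT (c : Fˣ) : genericShift c (genericT F) = genericT F := by
  simp [genericShift, genericT, twist_single]

theorem genericShift_genericX (c : Fˣ) :
    genericShift c (genericX F) = algebraMap F _ (c : F) * genericX F := by
  rw [genericShift, genericX, C_apply, twist_single, twist_single, ← Algebra.smul_def]
  have h : single (1 : ℤ) (c : F) = (c : F) • single (1 : ℤ) (1 : F) := by
    ext k
    by_cases hk : k = 1
    · simp [hk]
    · simp [coeff_single_of_ne hk]
  ext m n
  by_cases hm : m = 0
  · simp [hm, h]
  · simp [coeff_single_of_ne hm]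

theorem genericT_ne_zero : genericT F ≠ 0 := by simp [genericT]

theorem genericX_ne_zero : genericX F ≠ 0 := by simp [genericX]

theorem algebraMap_mul_genericX_sq_ne_one (c : F) :
    algebraMap F (GenericField F) c * genericX F ^ 2 ≠ 1 := by
  intro h
  rw [genericX, ← map_pow, HahnSeries.algebraMap_apply, ← map_mul, ← map_one C, C_injective.eq_iff] at h
  have := congrArg (fun f => f.coeff 0) h
  rw [HahnSeries.algebraMap_apply] at this
  simp [single_pow, coeff_single_of_ne] at this

theorem genericShift_pow_eq_one {c : Fˣ} {m : ℕ} (hc : c ^ m = 1) : genericShift c ^ m = 1 := by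
  rw [genericShift, twist_pow, twist_pow, hc]
  ext f i j
  simp [← AlgEquiv.aut_one]

theorem finrank_fixedField_zpowers_le {K : Type*} [Field K] [Algebra F K] {τ : K ≃ₐ[F] K} {m : ℕ}
    (hm : 0 < m) (h : τ ^ m = 1) :
    FiniteDimensional (IntermediateField.fixedField (Subgroup.zpowers τ)) K ∧
    Module.finrank (IntermediateField.fixedField (Subgroup.zpowers τ)) K ≤ m := by
  have hfin : IsOfFinOrder τ := isOfFinOrder_iff_pow_eq_one.mpr ⟨m, hm, h⟩
  have : Finite (Subgroup.zpowers τ) := by 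
    exact finite_zpowers.mpr hfin
  have := Fintype.ofFinite (Subgroup.zpowers τ)
  refine ⟨inferInstanceAs (FiniteDimensional (FixedPoints.subfield (Subgroup.zpowers τ) K) K), ?_⟩
  refine (FixedPoints.finrank_le_card (Subgroup.zpowers τ) K).trans ?_
  rw [← Nat.card_eq_fintype_card, Nat.card_zpowers]
  exact Nat.le_of_dvd hm (orderOf_dvd_of_pow_eq_one h)

end Generic

/-- The skew Laurent operator `u τ + v + w τ⁻¹`, linear over the fixed field of `τ`. -/
def skewOp {F K : Type*} [Field F] [Field K] [Algebra F K] (τ : K ≃ₐ[F] K) (u v w : K) :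
    Module.End (IntermediateField.fixedField (Subgroup.zpowers τ)) K where
  toFun f := u * τ f + v * f + w * τ.symm f
  map_add' f g := by simp only [map_add]; ring
  map_smul' c f := by
    have h1 : τ c = c := c.2 ⟨τ, Subgroup.mem_zpowers τ⟩
    have h2 : τ.symm c = c := by rw [AlgEquiv.symm_apply_eq, h1]
    simp only [IntermediateField.smul_def, smul_eq_mul, map_mul, h1, h2, RingHom.id_apply]
    ring

@[simp]
theorem skewOp_apply {F K : Type*} [Field F] [Field K] [Algebra F K] (τ : K ≃ₐ[F] K)
    (u v w f : K) : skewOp τ u v w f = u * τ f + v * f + w * τ.symm f := rfl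

section GenericOperators

variable {F K : Type*} [Field F] [Field K] [Algebra F K] (τ : K ≃ₐ[F] K) (q α β γ ω : F) (t x : K)

/-- The action of `A` in the generic representation. -/
def genA : Module.End (IntermediateField.fixedField (Subgroup.zpowers τ)) K :=
  skewOp τ t⁻¹ (awPsi (algebraMap F K q) (algebraMap F K α) (algebraMap F K γ) x)
    (t * awPhi (algebraMap F K q) (algebraMap F K α) (algebraMap F K β) (algebraMap F K γ)
      (algebraMap F K ω) x)

/-- The action of `B` in the generic representation. -/
def genB : Module.End (IntermediateField.fixedField (Subgroup.zpowers τ)) K :=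
  skewOp τ 0 (x + x⁻¹) 0

/-- The action of `C` in the generic representation. -/
def genC : Module.End (IntermediateField.fixedField (Subgroup.zpowers τ)) K :=
  skewOp τ (-(algebraMap F K q * x * t⁻¹))
    (awChi (algebraMap F K q) (algebraMap F K α) (algebraMap F K γ) x)
    (-(algebraMap F K q * x⁻¹ * (t * awPhi (algebraMap F K q) (algebraMap F K α)
      (algebraMap F K β) (algebraMap F K γ) (algebraMap F K ω) x)))

variable {τ q α β γ ω t x}

theorem genA_apply (f : K) : genA τ q α β γ ω t x f = t⁻¹ * τ f +
    awPsi (algebraMap F K q) (algebraMap F K α) (algebraMap F K γ) x * f +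
    t * awPhi (algebraMap F K q) (algebraMap F K α) (algebraMap F K β) (algebraMap F K γ)
      (algebraMap F K ω) x * τ.symm f := rfl

theorem genB_apply (f : K) : genB τ x f = (x + x⁻¹) * f := by
  simp [genB]

theorem genC_apply (f : K) : genC τ q α β γ ω t x f = -(algebraMap F K q * x * t⁻¹) * τ f +
    awChi (algebraMap F K q) (algebraMap F K α) (algebraMap F K γ) x * f +
    -(algebraMap F K q * x⁻¹ * (t * awPhi (algebraMap F K q) (algebraMap F K α)
      (algebraMap F K β) (algebraMap F K γ) (algebraMap F K ω) x)) * τ.symm f := rfl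

theorem symm_apply_eq_of_apply_eq {c x : K} (hc : c ≠ 0) (hcτ : τ c = c) (h : τ x = c * x) :
    τ.symm x = c⁻¹ * x := by
  rw [AlgEquiv.symm_apply_eq, map_mul, map_inv₀, hcτ, h, inv_mul_cancel_left₀ hc]

theorem map_awPsi {K' : Type*} [Field K'] (f : K →+* K') (q α γ x : K) :
    f (awPsi q α γ x) = awPsi (f q) (f α) (f γ) (f x) := by
  simp [awPsi]

theorem map_awChi {K' : Type*} [Field K'] (f : K →+* K') (q α γ x : K) :
    f (awChi q α γ x) = awChi (f q) (f α) (f γ) (f x) := by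
  simp [awChi, map_awPsi]

theorem map_awPhi {K' : Type*} [Field K'] (f : K →+* K') (q α β γ ω x : K) :
    f (awPhi q α β γ ω x) = awPhi (f q) (f α) (f β) (f γ) (f ω) (f x) := by
  simp [awPhi, awR, awS, map_awPsi, map_awChi]

theorem map_sq_add_one_ne_zero (hp : q ^ 2 + 1 ≠ 0) : algebraMap F K q ^ 2 + 1 ≠ 0 := by
  rw [← map_pow, ← map_one (algebraMap F K), ← map_add]
  exact (map_ne_zero _).mpr hp

theorem awPsi_symm_shift {q α γ x : K} : awPsi q α γ ((q ^ 2)⁻¹ * x) = awPsi q α γ (q ^ 2 * x⁻¹) := by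
  rw [← awPsi_inv]
  simp [mul_comm]

theorem awChi_symm_shift {q α γ x : K} : awChi q α γ ((q ^ 2)⁻¹ * x) = awChi q α γ (q ^ 2 * x⁻¹) := by
  rw [← awChi_inv]
  simp [mul_comm]

theorem rel_alpha (hq : q ≠ 0) (hx : x ≠ 0) (hp : q ^ 2 + 1 ≠ 0)
    (hgen : ∀ n : ℤ, algebraMap F K q ^ n * x ^ 2 ≠ 1) (hτ : τ x = algebraMap F K q ^ 2 * x) :
    q • (genB τ x * genC τ q α β γ ω t x) - q⁻¹ • (genC τ q α β γ ω t x * genB τ x) =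
      (q ^ 2 - q⁻¹ ^ 2) • (algebraMap F _ α - genA τ q α β γ ω t x) := by
  have hq' : algebraMap F K q ≠ 0 := by simpa
  have hp' := map_sq_add_one_ne_zero (K := K) hp
  have hτ' : τ.symm x = (algebraMap F K q ^ 2)⁻¹ * x :=
    symm_apply_eq_of_apply_eq (by positivity) (by simp) hτ
  have h0 := awPsi_mul (α := algebraMap F K α) (γ := algebraMap F K γ) hq' hx hp' hgen
  ext f
  simp only [LinearMap.sub_apply, LinearMap.smul_apply, Module.End.mul_apply,
    Module.algebraMap_end_apply, genA, genB, genC, skewOp_apply]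
  simp only [Algebra.smul_def, map_add, map_mul, map_sub, map_pow, map_inv₀, hτ, hτ',
    zero_mul, zero_add, add_zero]
  linear_combination (norm := (field_simp; ring)) f * h0

theorem rel_beta (hq : q ≠ 0) (hx : x ≠ 0) (hp : q ^ 2 + 1 ≠ 0) (ht : t ≠ 0)
    (hgen : ∀ n : ℤ, algebraMap F K q ^ n * x ^ 2 ≠ 1) (hτ : τ x = algebraMap F K q ^ 2 * x)
    (hτt : τ t = t) :
    q • (genC τ q α β γ ω t x * genA τ q α β γ ω t x)
      - q⁻¹ • (genA τ q α β γ ω t x * genC τ q α β γ ω t x) =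
      (q ^ 2 - q⁻¹ ^ 2) • (algebraMap F _ β - genB τ x) := by
  have hq' : algebraMap F K q ≠ 0 := by simpa
  have hp' := map_sq_add_one_ne_zero (K := K) hp
  have hτ' : τ.symm x = (algebraMap F K q ^ 2)⁻¹ * x :=
    symm_apply_eq_of_apply_eq (by positivity) (by simp) hτ
  have hτt' : τ.symm t = t := by rw [AlgEquiv.symm_apply_eq, hτt]
  have h1 := awPsi_awChi_rel (α := algebraMap F K α) (γ := algebraMap F K γ) hq' hx hp' hgen
  have h2 := awPsi_awChi_rel (α := algebraMap F K α) (γ := algebraMap F K γ) hq'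
    (inv_ne_zero hx) hp' (zpow_mul_inv_sq_ne_one hgen)
  rw [awPsi_inv, awChi_inv] at h2
  have h3 := awPhi_rel (α := algebraMap F K α) (β := algebraMap F K β) (γ := algebraMap F K γ)
    (ω := algebraMap F K ω) hq' hx hp' hgen
  rw [awS] at h3
  have m1 := fun q α γ x => map_awPsi (τ : K →+* K) q α γ x
  have m2 := fun q α γ x => map_awChi (τ : K →+* K) q α γ x
  have m3 := fun q α β γ ω x => map_awPhi (τ : K →+* K) q α β γ ω x
  have m4 := fun q α γ x => map_awPsi (τ.symm : K →+* K) q α γ x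
  have m5 := fun q α γ x => map_awChi (τ.symm : K →+* K) q α γ x
  have m6 := fun q α β γ ω x => map_awPhi (τ.symm : K →+* K) q α β γ ω x
  simp only [RingHom.coe_coe] at m1 m2 m3 m4 m5 m6
  ext f
  simp only [LinearMap.sub_apply, LinearMap.smul_apply, Module.End.mul_apply,
    Module.algebraMap_end_apply, genA, genB, genC, skewOp_apply]
  simp only [Algebra.smul_def, map_add, map_mul, map_sub, map_neg, map_pow, map_inv₀, hτ, hτ',
    hτt, hτt', zero_mul, zero_add, add_zero, m1, m2, m3, m4, m5, m6,
    AlgEquiv.commutes, AlgEquiv.apply_symm_apply, AlgEquiv.symm_apply_apply, awPsi_symm_shift,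
    awChi_symm_shift]
  linear_combination (norm := (field_simp; ring)) t⁻¹ * τ f * h1 + t * awPhi (algebraMap F K q)
    (algebraMap F K α) (algebraMap F K β) (algebraMap F K γ) (algebraMap F K ω) x * τ.symm f * h2
    + f * h3

theorem rel_gamma (hq : q ≠ 0) (hx : x ≠ 0) (hp : q ^ 2 + 1 ≠ 0)
    (hτ : τ x = algebraMap F K q ^ 2 * x) :
    q • (genA τ q α β γ ω t x * genB τ x) - q⁻¹ • (genB τ x * genA τ q α β γ ω t x) =
      (q ^ 2 - q⁻¹ ^ 2) • (algebraMap F _ γ - genC τ q α β γ ω t x) := by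
  have hq' : algebraMap F K q ≠ 0 := by simpa
  have hp' := map_sq_add_one_ne_zero (K := K) hp
  have hτ' : τ.symm x = (algebraMap F K q ^ 2)⁻¹ * x :=
    symm_apply_eq_of_apply_eq (by positivity) (by simp) hτ
  ext f
  simp only [LinearMap.sub_apply, LinearMap.smul_apply, Module.End.mul_apply,
    Module.algebraMap_end_apply, genA, genB, genC, skewOp_apply]
  simp only [Algebra.smul_def, map_add, map_mul, map_sub, map_pow, map_inv₀, hτ, hτ',
    zero_mul, zero_add, add_zero]
  have e2 : algebraMap F K q + (algebraMap F K q)⁻¹ = (algebraMap F K q ^ 2 + 1) / algebraMap F K q := by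
    field_simp
  rw [awChi, e2]
  field_simp
  ring

theorem rel_casimir (hq : q ≠ 0) (hx : x ≠ 0) (hp : q ^ 2 + 1 ≠ 0) (ht : t ≠ 0)
    (hgen : ∀ n : ℤ, algebraMap F K q ^ n * x ^ 2 ≠ 1) (hτ : τ x = algebraMap F K q ^ 2 * x)
    (hτt : τ t = t) :
    q • (genA τ q α β γ ω t x * genB τ x * genC τ q α β γ ω t x)
      + q ^ 2 • genA τ q α β γ ω t x ^ 2 + q⁻¹ ^ 2 • genB τ x ^ 2
      + q ^ 2 • genC τ q α β γ ω t x ^ 2 - (q * (q + q⁻¹) * α) • genA τ q α β γ ω t x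
      - (q⁻¹ * (q + q⁻¹) * β) • genB τ x - (q * (q + q⁻¹) * γ) • genC τ q α β γ ω t x =
      algebraMap F _ ω := by
  have hq' : algebraMap F K q ≠ 0 := by simpa
  have hp' := map_sq_add_one_ne_zero (K := K) hp
  have hτ' : τ.symm x = (algebraMap F K q ^ 2)⁻¹ * x :=
    symm_apply_eq_of_apply_eq (by positivity) (by simp) hτ
  have hτt' : τ.symm t = t := by rw [AlgEquiv.symm_apply_eq, hτt]
  have h1 := awPsi_awChi_casimir (α := algebraMap F K α) (γ := algebraMap F K γ) hq' hx hp' hgen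
  have h2 := awPsi_awChi_casimir (α := algebraMap F K α) (γ := algebraMap F K γ) hq'
    (inv_ne_zero hx) hp' (zpow_mul_inv_sq_ne_one hgen)
  rw [awPsi_inv, awChi_inv] at h2
  have h3 := awPhi_casimir (α := algebraMap F K α) (β := algebraMap F K β)
    (γ := algebraMap F K γ) (ω := algebraMap F K ω) hq' hx hp' hgen
  rw [awR] at h3
  have m1 := fun q α γ x => map_awPsi (τ : K →+* K) q α γ x
  have m2 := fun q α γ x => map_awChi (τ : K →+* K) q α γ x
  have m3 := fun q α β γ ω x => map_awPhi (τ : K →+* K) q α β γ ω x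
  have m4 := fun q α γ x => map_awPsi (τ.symm : K →+* K) q α γ x
  have m5 := fun q α γ x => map_awChi (τ.symm : K →+* K) q α γ x
  have m6 := fun q α β γ ω x => map_awPhi (τ.symm : K →+* K) q α β γ ω x
  simp only [RingHom.coe_coe] at m1 m2 m3 m4 m5 m6
  ext f
  simp only [LinearMap.sub_apply, LinearMap.add_apply, LinearMap.smul_apply, Module.End.mul_apply,
    Module.algebraMap_end_apply, genA, genB, genC, skewOp_apply, pow_two]
  simp only [Algebra.smul_def, map_add, map_mul, map_neg, map_inv₀, hτ, hτ',
    hτt, hτt', zero_mul, zero_add, add_zero, m1, m2, m3, m4, m5, m6,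
    AlgEquiv.commutes, AlgEquiv.apply_symm_apply, AlgEquiv.symm_apply_apply, awPsi_symm_shift,
    awChi_symm_shift]
  linear_combination (norm := (field_simp; ring)) t⁻¹ * τ f * h1 + t * awPhi (algebraMap F K q)
    (algebraMap F K α) (algebraMap F K β) (algebraMap F K γ) (algebraMap F K ω) x * τ.symm f * h2
    + f * h3

end GenericOperators

theorem linearIndependent_of_triangular {ι κ F M : Type*} [Field F] [AddCommGroup M] [Module F M]
    [LinearOrder κ] (key : ι → κ) (v : ι → M) (ℓ : ι → M →ₗ[F] F) (h1 : ∀ i, ℓ i (v i) ≠ 0)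
    (h0 : ∀ i j, j ≠ i → key j ≤ key i → ℓ i (v j) = 0) : LinearIndependent F v := by
  classical
  rw [linearIndependent_iff']
  intro s g hg
  by_contra! hne
  obtain ⟨i₀, hi₀, hgi₀⟩ := hne
  obtain ⟨i, hi, hmax⟩ := (s.filter fun i => g i ≠ 0).exists_max_image key
    ⟨i₀, Finset.mem_filter.mpr ⟨hi₀, hgi₀⟩⟩
  rw [Finset.mem_filter] at hi
  have := congrArg (ℓ i) hg
  rw [map_sum, map_zero, Finset.sum_eq_single i] at this
  · rw [map_smul, smul_eq_mul] at this
    exact mul_ne_zero hi.2 (h1 i) this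
  · intro j hj hji
    by_cases hgj : g j = 0
    · simp [hgj]
    · rw [map_smul, h0 i j hji (hmax j (Finset.mem_filter.mpr ⟨hj, hgj⟩)), smul_zero]
  · exact fun h => absurd hi.1 h

section LeadingCoefficient

open HahnSeries

variable {F : Type*} [Field F]

/-- The lowest term of `f` is `h t⁻ᵐ`, where `h` is allowed to vanish. -/
def HasLead {R : Type*} [Field R] (m : ℤ) (h : R) (f : HahnSeries ℤ R) : Prop :=
  (∀ n < -m, f.coeff n = 0) ∧ f.coeff (-m) = h

theorem HasLead.skew {R : Type*} [Field R] [Algebra F R] {σ : R ≃ₐ[F] R} {m : ℤ} {h : R}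
    {f : HahnSeries ℤ R} (hf : HasLead m h f) (u v w : R) :
    HasLead (m + 1) (u * σ h)
      (single (-1) u * twist σ 1 f + C v * f + single 1 w * (twist σ 1).symm f) := by
  refine ⟨fun n hn => ?_, ?_⟩
  · simp [coeff_single_mul, hf.1 n (by omega), hf.1 (n + 1) (by omega), hf.1 (n - 1) (by omega)]
  · simp only [coeff_add, coeff_single_mul, C_mul_eq_smul, coeff_smul, twist_coeff,
      twist_symm_coeff, hf.1 (-(m + 1)) (by omega), hf.1 (-(m + 1) - 1) (by omega),
      show -(m + 1) - -1 = -m by ring, hf.2]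
    simp

theorem HasLead.C_mul {R : Type*} [Field R] {m : ℤ} {h : R} {f : HahnSeries ℤ R}
    (hf : HasLead m h f) (v : R) : HasLead m (v * h) (C v * f) := by
  refine ⟨fun n hn => ?_, ?_⟩
  · simp [hf.1 n hn]
  · simp [hf.2]

theorem genericT_eq : genericT F = single 1 1 := rfl

theorem inv_genericT : (genericT F)⁻¹ = single (-1) 1 := by simp [genericT]

theorem awPsi_generic (q α γ : F) :
    awPsi (algebraMap F (GenericField F) q) (algebraMap F (GenericField F) α)
      (algebraMap F (GenericField F) γ) (genericX F) =
      C (awPsi (algebraMap F (HahnSeries ℤ F) q) (algebraMap F (HahnSeries ℤ F) α)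
        (algebraMap F (HahnSeries ℤ F) γ) (single 1 1)) := by
  simp only [map_awPsi, HahnSeries.algebraMap_apply, genericX]

theorem awChi_generic (q α γ : F) :
    awChi (algebraMap F (GenericField F) q) (algebraMap F (GenericField F) α)
      (algebraMap F (GenericField F) γ) (genericX F) =
      C (awChi (algebraMap F (HahnSeries ℤ F) q) (algebraMap F (HahnSeries ℤ F) α)
        (algebraMap F (HahnSeries ℤ F) γ) (single 1 1)) := by
  simp only [map_awChi, HahnSeries.algebraMap_apply, genericX]

theorem awPhi_generic (q α β γ ω : F) :
    awPhi (algebraMap F (GenericField F) q) (algebraMap F (GenericField F) α)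
      (algebraMap F (GenericField F) β) (algebraMap F (GenericField F) γ)
      (algebraMap F (GenericField F) ω) (genericX F) =
      C (awPhi (algebraMap F (HahnSeries ℤ F) q) (algebraMap F (HahnSeries ℤ F) α)
        (algebraMap F (HahnSeries ℤ F) β) (algebraMap F (HahnSeries ℤ F) γ)
        (algebraMap F (HahnSeries ℤ F) ω) (single 1 1)) := by
  simp only [map_awPhi, HahnSeries.algebraMap_apply, genericX]

variable {m : ℤ} {h : HahnSeries ℤ F} {f : GenericField F} {c : Fˣ} {q α β γ ω : F}

theorem HasLead.genA (hf : HasLead m h f) :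
    HasLead (m + 1) (twist AlgEquiv.refl c h)
      (genA (genericShift c) q α β γ ω (genericT F) (genericX F) f) := by
  have := hf.skew (σ := twist AlgEquiv.refl c) 1
    (awPsi (algebraMap F _ q) (algebraMap F _ α) (algebraMap F _ γ) (single 1 1))
    (awPhi (algebraMap F _ q) (algebraMap F _ α) (algebraMap F _ β) (algebraMap F _ γ)
        (algebraMap F _ ω) (single 1 1))
  convert this using 1
  · simp
  · rw [genA_apply, awPsi_generic, awPhi_generic, inv_genericT, genericT_eq,
      genericShift, C_apply, C_apply, single_mul_single, add_zero, one_mul]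

theorem HasLead.genC (hf : HasLead m h f) :
    HasLead (m + 1) (-(algebraMap F _ q * single 1 1) * twist AlgEquiv.refl c h)
      (genC (genericShift c) q α β γ ω (genericT F) (genericX F) f) := by
  have := hf.skew (σ := twist AlgEquiv.refl c) (-(algebraMap F _ q * single 1 1))
    (awChi (algebraMap F _ q) (algebraMap F _ α) (algebraMap F _ γ) (single 1 1))
    (-(algebraMap F _ q * (single 1 1)⁻¹ * awPhi (algebraMap F _ q) (algebraMap F _ α)
      (algebraMap F _ β) (algebraMap F _ γ) (algebraMap F _ ω) (single 1 1)))
  convert this using 1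
  rw [genC_apply, awChi_generic, awPhi_generic, inv_genericT, genericT_eq,
    genericShift, genericX, HahnSeries.algebraMap_apply, ← map_inv₀, ← map_mul, ← map_mul]
  simp only [C_apply, single_mul_single, HahnSeries.single_neg, zero_add, add_zero, mul_one, one_mul]

theorem HasLead.genB (hf : HasLead m h f) :
    HasLead m ((single 1 1 + (single 1 1)⁻¹) * h) (genB (genericShift c) (genericX F) f) := by
  convert hf.C_mul (single 1 1 + (single 1 1)⁻¹) using 1
  simp [genB_apply, genericX]

theorem coeff_pow_mul_pow (j k : ℕ) :
    (∀ e : ℤ, (e < k - j ∨ k + j < e) → ((single (1 : ℤ) (1 : F) + (single 1 1)⁻¹) ^ j *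
      single 1 1 ^ k).coeff e = 0) ∧
    ((single (1 : ℤ) (1 : F) + (single 1 1)⁻¹) ^ j * single 1 1 ^ k).coeff (k - j : ℤ) = 1 ∧
    ((single (1 : ℤ) (1 : F) + (single 1 1)⁻¹) ^ j * single 1 1 ^ k).coeff (k + j : ℤ) = 1 := by
  induction j with
  | zero =>
    simp only [pow_zero, one_mul, single_pow, one_pow, Nat.cast_zero, sub_zero, add_zero, nsmul_one,
      coeff_single_same, and_self, and_true]
    intro e he
    rw [coeff_single_of_ne (by omega)]
  | succ j ih =>
    obtain ⟨h0, h1, h2⟩ := ih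
    have key (e : ℤ) : ((single (1 : ℤ) (1 : F) + (single 1 1)⁻¹) ^ (j + 1) *
        single 1 1 ^ k).coeff e = ((single (1 : ℤ) (1 : F) + (single 1 1)⁻¹) ^ j *
        single 1 1 ^ k).coeff (e - 1) + ((single (1 : ℤ) (1 : F) + (single 1 1)⁻¹) ^ j *
        single 1 1 ^ k).coeff (e + 1) := by
      rw [pow_succ', mul_assoc]
      generalize (single (1 : ℤ) (1 : F) + (single 1 1)⁻¹) ^ j * single 1 1 ^ k = g
      simp [add_mul, coeff_single_mul]
    push_cast
    refine ⟨fun e he => ?_, ?_, ?_⟩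
    · rw [key, h0 _ (by omega), h0 _ (by omega), add_zero]
    · rw [key, h0 (k - (j + 1) - 1) (by omega), zero_add,
        show (k - (j + 1) + 1 : ℤ) = k - j by ring, h1]
    · rw [key, h0 (k + (j + 1) + 1) (by omega), add_zero,
        show (k + (j + 1) - 1 : ℤ) = k + j by ring, h2]

theorem twist_pow_single_one (c : Fˣ) (s : F) (k : ℕ) :
    twist AlgEquiv.refl c (s • single (1 : ℤ) (1 : F) ^ k) =
      ((c : F) ^ k * s) • single (1 : ℤ) (1 : F) ^ k := by
  rw [single_pow, map_smul, twist_single]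
  ext n
  by_cases hn : n = k
  · simp [hn, mul_comm]
  · simp [coeff_single_of_ne, hn]

theorem exists_hasLead_monomial (hq : q ≠ 0) (j i k : ℕ) :
    ∃ s : F, s ≠ 0 ∧ HasLead (i + k : ℤ)
      (s • ((single (1 : ℤ) (1 : F) + (single 1 1)⁻¹) ^ j * single 1 1 ^ k))
      ((genB (genericShift c) (genericX F) ^ j *
        genA (genericShift c) q α β γ ω (genericT F) (genericX F) ^ i *
        genC (genericShift c) q α β γ ω (genericT F) (genericX F) ^ k) 1) := by
  induction j with
  | zero =>
    induction i with
    | zero =>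
      induction k with
      | zero =>
        refine ⟨1, one_ne_zero, fun n hn => ?_, ?_⟩
        · simp only [CharP.cast_eq_zero, add_zero, neg_zero] at hn
          simp [coeff_one, hn.ne]
        · simp
      | succ k ih =>
        obtain ⟨s, hs, h⟩ := ih
        simp only [pow_zero, one_mul] at h ⊢
        refine ⟨-(q * (c ^ k * s)), by simp [hq, hs], ?_⟩
        convert h.genC (c := c) (q := q) (α := α) (β := β) (γ := γ) (ω := ω) using 1
        · push_cast
          ring
        · rw [twist_pow_single_one, Algebra.smul_def, Algebra.smul_def, map_neg, map_mul, pow_succ]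
          ring
        · rw [pow_succ', Module.End.mul_apply]
    | succ i ih =>
      obtain ⟨s, hs, h⟩ := ih
      simp only [pow_zero, one_mul] at h ⊢
      refine ⟨c ^ k * s, by simp [hs], ?_⟩
      convert h.genA (c := c) (q := q) (α := α) (β := β) (γ := γ) (ω := ω) using 1
      · push_cast
        ring
      · rw [twist_pow_single_one]
      · rw [pow_succ', mul_assoc, Module.End.mul_apply]
  | succ j ih =>
    obtain ⟨s, hs, h⟩ := ih
    refine ⟨s, hs, ?_⟩
    convert h.genB (c := c) using 1
    · rw [Algebra.smul_def, Algebra.smul_def, pow_succ]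
      ring
    · rw [pow_succ', mul_assoc, mul_assoc, Module.End.mul_apply, ← mul_assoc]

/-- The coefficient of `xᵉ tⁿ`, as a linear functional. -/
def coeffFunctional (n e : ℤ) : GenericField F →ₗ[F] F where
  toFun f := (f.coeff n).coeff e
  map_add' f g := by simp
  map_smul' s f := by simp

theorem linearIndependent_monomials (hq : q ≠ 0) :
    LinearIndependent F fun T : {T : ℕ × ℕ × ℕ // T.1 * T.2.1 * T.2.2 = 0} =>
      (genB (genericShift c) (genericX F) ^ T.1.1 *
        genA (genericShift c) q α β γ ω (genericT F) (genericX F) ^ T.1.2.1 *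
        genC (genericShift c) q α β γ ω (genericT F) (genericX F) ^ T.1.2.2) 1 := by
  refine linearIndependent_of_triangular
    (fun T => toLex (T.1.2.1 + T.1.2.2, if T.1.1 = 0 then ((T.1.2.1 : ℤ) - T.1.2.2).natAbs else
      T.1.2.1 + T.1.2.2 + 2 * T.1.1)) _
    (fun T => coeffFunctional (-(T.1.2.1 + T.1.2.2))
      (if T.1.2.2 = 0 then - T.1.1 else T.1.2.2 + T.1.1)) ?_ ?_
  · rintro ⟨⟨j, i, k⟩, h⟩
    obtain ⟨s, hs, -, hl⟩ := exists_hasLead_monomial (c := c) (α := α) (β := β) (γ := γ) (ω := ω)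
      hq j i k
    obtain ⟨-, h1, h2⟩ := coeff_pow_mul_pow (F := F) j k
    simp only [coeffFunctional, LinearMap.coe_mk, AddHom.coe_mk, hl]
    split_ifs with hk
    · subst hk
      rw [Nat.cast_zero, zero_sub] at h1
      rw [coeff_smul, h1]
      simpa
    · rw [coeff_smul, h2]
      simpa
  · rintro ⟨⟨j, i, k⟩, h⟩ ⟨⟨j', i', k'⟩, h'⟩ hne hkey
    obtain ⟨s, hs, hz, hl⟩ := exists_hasLead_monomial (c := c) (α := α) (β := β) (γ := γ) (ω := ω)
      hq j' i' k'
    obtain ⟨h0, -, -⟩ := coeff_pow_mul_pow (F := F) j' k'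
    simp only [coeffFunctional, LinearMap.coe_mk, AddHom.coe_mk]
    simp only [Prod.Lex.toLex_le_toLex] at hkey
    simp only [ne_eq, Subtype.mk.injEq, Prod.mk.injEq] at hne
    simp only [mul_eq_zero] at h h'
    rcases hkey with hlt | ⟨heq, hle⟩
    · rw [hz _ (by omega), coeff_zero]
    · rw [show (-(i + k : ℤ)) = -(i' + k') by omega, hl, coeff_smul, h0, smul_zero]
      split_ifs at hle ⊢ <;> omega

end LeadingCoefficient

/-- The elements `a, b, c` satisfy the relations of `△_q` with the central elements
`A + (qBC − q⁻¹CB)/(q² − q⁻²)`, … specialised to the scalars `α, β, γ`. -/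
structure IsAWTriple {F P : Type*} [Field F] [Ring P] [Algebra F P] (q α β γ : F) (a b c : P) :
    Prop where
  alpha : q • (b * c) - q⁻¹ • (c * b) = (q ^ 2 - q⁻¹ ^ 2) • (algebraMap F P α - a)
  beta : q • (c * a) - q⁻¹ • (a * c) = (q ^ 2 - q⁻¹ ^ 2) • (algebraMap F P β - b)
  gamma : q • (a * b) - q⁻¹ • (b * a) = (q ^ 2 - q⁻¹ ^ 2) • (algebraMap F P γ - c)

/-- The Casimir element. -/
def awCasimir {F P : Type*} [Field F] [Ring P] [Algebra F P] (q α β γ : F) (a b c : P) : P :=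
  q • (a * b * c) + q ^ 2 • a ^ 2 + q⁻¹ ^ 2 • b ^ 2 + q ^ 2 • c ^ 2 - (q * (q + q⁻¹) * α) • a
    - (q⁻¹ * (q + q⁻¹) * β) • b - (q * (q + q⁻¹) * γ) • c

namespace IsAWTriple

variable {F P : Type*} [Field F] [Ring P] [Algebra F P] {q α β γ ω : F} {a b c : P}

theorem mul_ba (h : IsAWTriple q α β γ a b c) (hq : q ≠ 0) :
    b * a = q ^ 2 • (a * b) - (q * (q ^ 2 - q⁻¹ ^ 2) * γ) • 1 + (q * (q ^ 2 - q⁻¹ ^ 2)) • c := by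
  have := congrArg (fun z => (-q) • z) h.gamma
  rw [Algebra.algebraMap_eq_smul_one] at this
  simp only [smul_sub, smul_smul, neg_mul, mul_inv_cancel₀ hq] at this
  linear_combination (norm := skip) this
  match_scalars <;> ring

theorem mul_cb (h : IsAWTriple q α β γ a b c) (hq : q ≠ 0) :
    c * b = q ^ 2 • (b * c) - (q * (q ^ 2 - q⁻¹ ^ 2) * α) • 1 + (q * (q ^ 2 - q⁻¹ ^ 2)) • a := by
  have := congrArg (fun z => (-q) • z) h.alpha
  rw [Algebra.algebraMap_eq_smul_one] at this
  simp only [smul_sub, smul_smul, neg_mul, mul_inv_cancel₀ hq] at this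
  linear_combination (norm := skip) this
  match_scalars <;> ring

theorem mul_ca (h : IsAWTriple q α β γ a b c) (hq : q ≠ 0) :
    c * a = q⁻¹ ^ 2 • (a * c) + (q⁻¹ * (q ^ 2 - q⁻¹ ^ 2) * β) • 1
      - (q⁻¹ * (q ^ 2 - q⁻¹ ^ 2)) • b := by
  have := congrArg (fun z => q⁻¹ • z) h.beta
  rw [Algebra.algebraMap_eq_smul_one] at this
  simp only [smul_sub, smul_smul, inv_mul_cancel₀ hq] at this
  linear_combination (norm := skip) this
  match_scalars <;> ring

theorem casimir_comm (h : IsAWTriple q α β γ a b c) (hq : q ≠ 0) :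
    Commute (awCasimir q α β γ a b c) a ∧ Commute (awCasimir q α β γ a b c) b ∧
      Commute (awCasimir q α β γ a b c) c := by
  have hba := h.mul_ba hq
  have hcb := h.mul_cb hq
  have hca := h.mul_ca hq
  have hba' (z : P) := congrArg (· * z) hba
  have hcb' (z : P) := congrArg (· * z) hcb
  have hca' (z : P) := congrArg (· * z) hca
  simp only [mul_assoc, add_mul, sub_mul, smul_mul_assoc, one_mul] at hba' hcb' hca'
  refine ⟨?_, ?_, ?_⟩ <;>
  · simp only [Commute, SemiconjBy, awCasimir, pow_two a, pow_two b, pow_two c, mul_add, add_mul,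
      mul_sub, sub_mul, smul_mul_assoc, mul_smul_comm, mul_assoc, hba, hca, hcb, hba', hca', hcb',
      mul_one]
    match_scalars <;> field_simp <;> ring

theorem adjoin_le (h : IsAWTriple q α β γ a b c) (hq : q ≠ 0)
    (hω : awCasimir q α β γ a b c = algebraMap F P ω) :
    Subalgebra.toSubmodule (Algebra.adjoin F {a, b, c}) ≤ Submodule.span F
      {p | ∃ j i k : ℕ, j * i * k = 0 ∧ p = b ^ j * a ^ i * c ^ k} := by
  set M := Submodule.span F {1, a, b, c} with hM
  have h1 : (1 : P) ∈ M := Submodule.subset_span (by simp)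
  have ha : a ∈ M := Submodule.subset_span (by simp)
  have hb : b ∈ M := Submodule.subset_span (by simp)
  have hc : c ∈ M := Submodule.subset_span (by simp)
  have hMM {y z : P} (hy : y ∈ M) (hz : z ∈ M) : y * z ∈ M ^ 2 := by
    rw [pow_two]
    exact Submodule.mul_mem_mul hy hz
  have hM2 {z : P} (hz : z ∈ M) : z ∈ M ^ 2 := by
    simpa using hMM hz h1
  refine adjoin_le_span_monomials hM (r := q⁻¹ ^ 2) (s := q ^ 2) (t := q⁻¹ ^ 2) (by positivity)
    ?_ ?_ ?_ ?_
  · have : a * b - q⁻¹ ^ 2 • (b * a) =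
        (q⁻¹ * (q ^ 2 - q⁻¹ ^ 2) * γ) • 1 - (q⁻¹ * (q ^ 2 - q⁻¹ ^ 2)) • c := by
      rw [h.mul_ba hq]
      match_scalars <;> field_simp <;> ring
    rw [this]
    exact sub_mem (M.smul_mem _ h1) (M.smul_mem _ hc)
  · have : c * b - q ^ 2 • (b * c) =
        (q * (q ^ 2 - q⁻¹ ^ 2)) • a - (q * (q ^ 2 - q⁻¹ ^ 2) * α) • 1 := by
      rw [h.mul_cb hq]
      module
    rw [this]
    exact sub_mem (M.smul_mem _ ha) (M.smul_mem _ h1)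
  · have : c * a - q⁻¹ ^ 2 • (a * c) =
        (q⁻¹ * (q ^ 2 - q⁻¹ ^ 2) * β) • 1 - (q⁻¹ * (q ^ 2 - q⁻¹ ^ 2)) • b := by
      rw [h.mul_ca hq]
      module
    rw [this]
    exact sub_mem (M.smul_mem _ h1) (M.smul_mem _ hb)
  · have : b * a * c = q • (algebraMap F P ω - (q ^ 2 • (a * a) + q⁻¹ ^ 2 • (b * b)
        + q ^ 2 • (c * c) - (q * (q + q⁻¹) * α) • a - (q⁻¹ * (q + q⁻¹) * β) • b
        - (q * (q + q⁻¹) * γ) • c)) - (q * (q ^ 2 - q⁻¹ ^ 2) * γ) • c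
        + (q * (q ^ 2 - q⁻¹ ^ 2)) • (c * c) := by
      rw [← hω, h.mul_ba hq, awCasimir]
      simp only [add_mul, sub_mul, smul_mul_assoc, one_mul, pow_two a, pow_two b, pow_two c]
      module
    rw [this, Algebra.algebraMap_eq_smul_one]
    have := hM2 h1
    have := hM2 ha
    have := hM2 hb
    have := hM2 hc
    have := hMM ha ha
    have := hMM hb hb
    have := hMM hc hc
    refine add_mem (sub_mem (Submodule.smul_mem _ _ (sub_mem ?_ (sub_mem (sub_mem (sub_mem
      (add_mem (add_mem ?_ ?_) ?_) ?_) ?_) ?_))) ?_) ?_ <;>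
    exact Submodule.smul_mem _ _ (by assumption)

end IsAWTriple

/-- If the monomials `bʲ aⁱ cᵏ` with `j i k = 0` are linearly independent for one triple, then a
relation between its members holds for every triple with the same parameters. -/
theorem IsAWTriple.lift_eq_zero {F P Q : Type*} [Field F] [Ring P] [Algebra F P] [Ring Q]
    [Algebra F Q] {q α β γ ω : F} {a b c : P} {a' b' c' : Q} (h : IsAWTriple q α β γ a b c)
    (hω : awCasimir q α β γ a b c = algebraMap F P ω) (h' : IsAWTriple q α β γ a' b' c')
    (hω' : awCasimir q α β γ a' b' c' = algebraMap F Q ω) (hq : q ≠ 0)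
    (hli : LinearIndependent F fun T : {T : ℕ × ℕ × ℕ // T.1 * T.2.1 * T.2.2 = 0} =>
      b ^ T.1.1 * a ^ T.1.2.1 * c ^ T.1.2.2)
    {r : FreeAlgebra F (Fin 3)} (hr : FreeAlgebra.lift F ![a, b, c] r = 0) :
    FreeAlgebra.lift F ![a', b', c'] r = 0 := by
  have hP : IsAWTriple q α β γ (a, a') (b, b') (c, c') :=
    ⟨Prod.ext h.alpha h'.alpha, Prod.ext h.beta h'.beta, Prod.ext h.gamma h'.gamma⟩
  have hPω : awCasimir q α β γ (a, a') (b, b') (c, c') = algebraMap F (P × Q) ω :=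
    Prod.ext hω hω'
  set φ := FreeAlgebra.lift F ![(a, a'), (b, b'), (c, c')] with hφ
  have hfst : (AlgHom.fst F P Q).comp φ = FreeAlgebra.lift F ![a, b, c] := by
    ext i
    fin_cases i <;> simp [hφ]
  have hsnd : (AlgHom.snd F P Q).comp φ = FreeAlgebra.lift F ![a', b', c'] := by
    ext i
    fin_cases i <;> simp [hφ]
  have hmem : φ r ∈ Algebra.adjoin F {(a, a'), (b, b'), (c, c')} := by
    have : φ.range ≤ Algebra.adjoin F {(a, a'), (b, b'), (c, c')} := by
      rw [hφ, ← Algebra.adjoin_range_eq_range_freeAlgebra_lift]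
      refine Algebra.adjoin_mono ?_
      rintro _ ⟨i, rfl⟩
      fin_cases i <;> simp
    exact this ⟨r, rfl⟩
  have hspan := hP.adjoin_le hq hPω hmem
  have hset : {p : P × Q | ∃ j i k : ℕ, j * i * k = 0 ∧
      p = (b, b') ^ j * (a, a') ^ i * (c, c') ^ k} =
      Set.range fun T : {T : ℕ × ℕ × ℕ // T.1 * T.2.1 * T.2.2 = 0} =>
        (b, b') ^ T.1.1 * (a, a') ^ T.1.2.1 * (c, c') ^ T.1.2.2 := by
    ext p
    constructor
    · rintro ⟨j, i, k, h0, rfl⟩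
      exact ⟨⟨(j, i, k), h0⟩, rfl⟩
    · rintro ⟨⟨⟨j, i, k⟩, h0⟩, rfl⟩
      exact ⟨j, i, k, h0, rfl⟩
  rw [hset, Finsupp.mem_span_range_iff_exists_finsupp] at hspan
  obtain ⟨s, hs⟩ := hspan
  have h1 := congrArg (AlgHom.fst F P Q) hs
  rw [show AlgHom.fst F P Q (φ r) = 0 from (DFunLike.congr_fun hfst r).trans hr] at h1
  have hs0 : s = 0 := by
    refine (linearIndependent_iff.mp hli) s ?_
    rw [Finsupp.linearCombination_apply, ← h1, map_finsuppSum]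
    simp
  rw [← hsnd, AlgHom.comp_apply, ← hs, hs0]
  simp

section SimpleModule

variable {F : Type*} [Field F] [IsAlgClosed F] {q : F} {V : Type*} [AddCommGroup V] [Module F V]
  [Module (UAW F q) V] [IsScalarTower F (UAW F q) V] [FiniteDimensional F V]
  [IsSimpleModule (UAW F q) V]

theorem UAW.adjoin_eq_top (F : Type*) [Field F] (q : F) :
    Algebra.adjoin F {awA F q, awB F q, awC F q} = ⊤ := by
  have h := congrArg (Subalgebra.map (RingQuot.mkAlgHom F (awRel F q)))
    (FreeAlgebra.adjoin_range_ι F (Fin 3))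
  rw [AlgHom.map_adjoin, Algebra.map_top, (AlgHom.range_eq_top _).mpr
    (RingQuot.mkAlgHom_surjective F (awRel F q))] at h
  rw [← h]
  congr 1
  ext p
  simp [Fin.exists_fin_succ, awA, awB, awC, awX, eq_comm]

/-- An operator on a simple module commuting with the generators is a scalar. -/
theorem UAW.exists_eq_algebraMap_of_commute {g : Module.End F V}
    (hA : Commute g (Algebra.lsmul F F V (awA F q))) (hB : Commute g (Algebra.lsmul F F V (awB F q)))
    (hC : Commute g (Algebra.lsmul F F V (awC F q))) : ∃ s : F, g = algebraMap F _ s := by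
  have hall : ∀ u : UAW F q, Commute g (Algebra.lsmul F F V u) := by
    intro u
    have hle : Algebra.adjoin F {awA F q, awB F q, awC F q} ≤
        (Subalgebra.centralizer F {g}).comap (Algebra.lsmul F F V) := by
      rw [Algebra.adjoin_le_iff]
      rintro _ (rfl | rfl | rfl) <;>
      simp only [SetLike.mem_coe, Subalgebra.mem_comap, Subalgebra.mem_centralizer_iff,
        Set.mem_singleton_iff, forall_eq] <;> assumption
    rw [UAW.adjoin_eq_top] at hle
    have := hle (Algebra.mem_top (x := u))
    simpa [Subalgebra.mem_centralizer_iff, Commute, SemiconjBy] using this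
  obtain ⟨s, hs⟩ := exists_forall_eq_smul_of_isSimpleModule (F := F)
    ({ toFun := g, map_add' := map_add g, map_smul' := fun u v =>
        DFunLike.congr_fun (hall u).eq v } : Module.End (UAW F q) V)
  exact ⟨s, LinearMap.ext hs⟩

theorem UAW.exists_isAWTriple (hq : q ≠ 0) (hq4 : q ^ 2 - q⁻¹ ^ 2 ≠ 0) :
    ∃ α β γ ω : F,
      IsAWTriple q α β γ (Algebra.lsmul F F V (awA F q)) (Algebra.lsmul F F V (awB F q))
        (Algebra.lsmul F F V (awC F q)) ∧
      awCasimir q α β γ (Algebra.lsmul F F V (awA F q)) (Algebra.lsmul F F V (awB F q))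
        (Algebra.lsmul F F V (awC F q)) = algebraMap F (Module.End F V) ω := by
  have hcomm (i j : Fin 3) : Commute
      (Algebra.lsmul F F V (RingQuot.mkAlgHom F (awRel F q) (awCand F q i)))
      (Algebra.lsmul F F V (RingQuot.mkAlgHom F (awRel F q) (awX F j))) := by
    rw [Commute, SemiconjBy, ← map_mul, ← map_mul, ← map_mul, ← map_mul,
      RingQuot.mkAlgHom_rel F (awRel.comm i j)]
  have hscalar (i : Fin 3) := UAW.exists_eq_algebraMap_of_commute (hcomm i 0) (hcomm i 1) (hcomm i 2)
  obtain ⟨α, hα⟩ := hscalar 0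
  obtain ⟨β, hβ⟩ := hscalar 1
  obtain ⟨γ, hγ⟩ := hscalar 2
  have key : IsAWTriple q α β γ (Algebra.lsmul F F V (awA F q)) (Algebra.lsmul F F V (awB F q))
      (Algebra.lsmul F F V (awC F q)) := by
    refine ⟨?_, ?_, ?_⟩
    · rw [← hα]
      simp only [awCand, map_add, map_sub, map_mul, map_smul, awA, awB, awC, add_sub_cancel_left,
        smul_smul, mul_inv_cancel₀ hq4, one_smul]
    · rw [← hβ]
      simp only [awCand, map_add, map_sub, map_mul, map_smul, awA, awB, awC, add_sub_cancel_left,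
        smul_smul, mul_inv_cancel₀ hq4, one_smul]
    · rw [← hγ]
      simp only [awCand, map_add, map_sub, map_mul, map_smul, awA, awB, awC, add_sub_cancel_left,
        smul_smul, mul_inv_cancel₀ hq4, one_smul]
  obtain ⟨hA, hB, hC⟩ := key.casimir_comm hq
  obtain ⟨ω, hω⟩ := UAW.exists_eq_algebraMap_of_commute hA hB hC
  exact ⟨α, β, γ, ω, key, hω⟩

end SimpleModule

/-- Operators are linearly independent over a subfield if their values at some vector are. -/
theorem linearIndependent_of_apply {ι F L M : Type*} [Field F] [Field L] [AddCommGroup M]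
    [Module F M] [Module L M] [SMulCommClass L F M] {g : ι → Module.End L M} (v : M)
    (h : LinearIndependent F fun i => g i v) : LinearIndependent F g :=
  LinearIndependent.of_comp
    ({ toFun := fun g => g v, map_add' := fun _ _ => rfl, map_smul' := fun _ _ => rfl } :
      Module.End L M →ₗ[F] M) h

/-- Comparison of a simple `△_q`-module with a representation of the same parameters in which the
monomials `bʲ aⁱ cᵏ` with `j i k = 0` are linearly independent. -/
theorem UAW.sq_finrank_le {F L E V : Type*} [Field F] [IsAlgClosed F] [Field L] [Ring E]
    [Algebra F E] [Algebra L E] [Module.Finite L E] [AddCommGroup V] [Module F V] {q α β γ ω : F}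
    [Module (UAW F q) V] [IsScalarTower F (UAW F q) V] [FiniteDimensional F V]
    [IsSimpleModule (UAW F q) V] {a b c : E} (hq : q ≠ 0) (h : IsAWTriple q α β γ a b c)
    (hω : awCasimir q α β γ a b c = algebraMap F E ω)
    (hV : IsAWTriple q α β γ (Algebra.lsmul F F V (awA F q)) (Algebra.lsmul F F V (awB F q))
      (Algebra.lsmul F F V (awC F q)))
    (hVω : awCasimir q α β γ (Algebra.lsmul F F V (awA F q)) (Algebra.lsmul F F V (awB F q))
      (Algebra.lsmul F F V (awC F q)) = algebraMap F (Module.End F V) ω)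
    (hli : LinearIndependent F fun T : {T : ℕ × ℕ × ℕ // T.1 * T.2.1 * T.2.2 = 0} =>
      b ^ T.1.1 * a ^ T.1.2.1 * c ^ T.1.2.2) :
    Module.finrank F V ^ 2 ≤ Module.finrank L E := by
  set A := Algebra.lsmul F F V (awA F q) with hA
  set B := Algebra.lsmul F F V (awB F q) with hB
  set C := Algebra.lsmul F F V (awC F q) with hC
  have hlift : FreeAlgebra.lift F ![A, B, C] =
      (Algebra.lsmul F F V).comp (RingQuot.mkAlgHom F (awRel F q)) := by
    ext : 1
    funext i
    fin_cases i <;> simp [hA, hB, hC, awA, awB, awC, awX]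
  have hsurj : Function.Surjective (FreeAlgebra.lift F ![A, B, C]) := by
    rw [hlift]
    exact lsmul_surjective_of_isSimpleModule.comp (RingQuot.mkAlgHom_surjective F (awRel F q))
  let M := LinearMap.toMatrixAlgEquiv (Module.finBasis F V)
  let φ : FreeAlgebra F (Fin 3) →+* E := (FreeAlgebra.lift F ![a, b, c]).toRingHom
  let ψ : FreeAlgebra F (Fin 3) →+* Matrix _ _ F :=
    (M.toAlgHom.comp (FreeAlgebra.lift F ![A, B, C])).toRingHom
  have hψ : Function.Surjective ψ := M.surjective.comp hsurj
  exact sq_le_finrank_of_ker_le φ ψ hψ fun r hr => by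
    have : FreeAlgebra.lift F ![A, B, C] r = 0 := h.lift_eq_zero hω hV hVω hq hli hr
    exact (congrArg M this).trans (map_zero M)

/-- A simple module over `△_q` has dimension at most the order of `τ`, provided that `τ`, `t`, `x`
give a generic representation with linearly independent monomials. -/
theorem UAW.finrank_le_of_generic {F K : Type*} [Field F] [IsAlgClosed F] [Field K] [Algebra F K]
    {q : F} {τ : K ≃ₐ[F] K} {t x : K} {m : ℕ} (hq : q ≠ 0) (hq4 : q ^ 4 ≠ 1) (hm : 0 < m)
    (hτm : τ ^ m = 1) (hx : x ≠ 0) (ht : t ≠ 0)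
    (hgen : ∀ n : ℤ, algebraMap F K q ^ n * x ^ 2 ≠ 1) (hτ : τ x = algebraMap F K q ^ 2 * x)
    (hτt : τ t = t)
    (hli : ∀ α β γ ω : F, LinearIndependent F
      fun T : {T : ℕ × ℕ × ℕ // T.1 * T.2.1 * T.2.2 = 0} =>
        (genB τ x ^ T.1.1 * genA τ q α β γ ω t x ^ T.1.2.1 * genC τ q α β γ ω t x ^ T.1.2.2) 1)
    (V : Type*) [AddCommGroup V] [Module F V] [Module (UAW F q) V] [IsScalarTower F (UAW F q) V]
    [FiniteDimensional F V] [IsSimpleModule (UAW F q) V] : Module.finrank F V ≤ m := by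
  have hp : q ^ 2 + 1 ≠ 0 := fun h => hq4 (by linear_combination (q ^ 2 - 1) * h)
  have hsub : q ^ 2 - q⁻¹ ^ 2 ≠ 0 := fun h => hq4 (by
    field_simp at h
    linear_combination h)
  obtain ⟨α, β, γ, ω, hV, hVω⟩ := UAW.exists_isAWTriple (V := V) hq hsub
  obtain ⟨hfin, hle⟩ := finrank_fixedField_zpowers_le hm hτm
  have h : IsAWTriple q α β γ (genA τ q α β γ ω t x) (genB τ x) (genC τ q α β γ ω t x) :=
    ⟨rel_alpha hq hx hp hgen hτ, rel_beta hq hx hp ht hgen hτ hτt, rel_gamma hq hx hp hτ⟩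
  have hω := rel_casimir (α := α) (β := β) (γ := γ) (ω := ω) hq hx hp ht hgen hτ hτt
  have hli' := linearIndependent_of_apply 1 (hli α β γ ω)
  have key := UAW.sq_finrank_le (L := IntermediateField.fixedField (Subgroup.zpowers τ)) hq h hω
    hV hVω hli'
  rw [Module.finrank_linearMap, ← pow_two] at key
  exact (Nat.pow_le_pow_iff_left two_ne_zero).mp (key.trans (Nat.pow_le_pow_left hle 2))

/-- A simple module over `△_q` has dimension at most the order of `q²`. -/
theorem UAW.finrank_le_of_pow_eq_one {F : Type*} [Field F] [IsAlgClosed F] {q : F} {m : ℕ}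
    (hq : q ≠ 0) (hq4 : q ^ 4 ≠ 1) (hm : 0 < m) (hqm : (q ^ 2) ^ m = 1) (V : Type*)
    [AddCommGroup V] [Module F V] [Module (UAW F q) V] [IsScalarTower F (UAW F q) V]
    [FiniteDimensional F V] [IsSimpleModule (UAW F q) V] : Module.finrank F V ≤ m := by
  let c : Fˣ := Units.mk0 (q ^ 2) (pow_ne_zero 2 hq)
  have hc : c ^ m = 1 := Units.ext (by simpa [c] using hqm)
  refine UAW.finrank_le_of_generic (τ := genericShift c) hq hq4 hm (genericShift_pow_eq_one hc)
    genericX_ne_zero genericT_ne_zero (fun n => ?_) ?_ (genericShift_genericT c)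
    (fun α β γ ω => linearIndependent_monomials hq) V
  · rw [← map_zpow₀]
    exact algebraMap_mul_genericX_sq_ne_one _
  · rw [genericShift_genericX, ← map_pow]
    rfl

/-- Every finite-dimensional irreducible module over the universal Askey–Wilson
algebra `△_q` has dimension at most `đ`, where `đ = d` if `d` is odd and
`đ = d/2` if `d` is even. -/
theorem uaw_finrank_le_dbar {𝔽 : Type*} [Field 𝔽] [IsAlgClosed 𝔽]
    {d : ℕ} (hd : 0 < d) (hd1 : d ≠ 1) (hd2 : d ≠ 2) (hd4 : d ≠ 4)
    {q : 𝔽} (hq : IsPrimitiveRoot q d)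
    (V : Type*) [AddCommGroup V] [Module 𝔽 V] [Module (UAW 𝔽 q) V]
    [IsScalarTower 𝔽 (UAW 𝔽 q) V] [FiniteDimensional 𝔽 V]
    [IsSimpleModule (UAW 𝔽 q) V] :
    Module.finrank 𝔽 V ≤ (if Odd d then d else d / 2) := by
  have hq4 : q ^ 4 ≠ 1 := fun h => by
    have h4 : d ∣ 4 := hq.dvd_of_pow_eq_one 4 h
    have := Nat.le_of_dvd (by norm_num) h4
    interval_cases d <;> omega
  refine UAW.finrank_le_of_pow_eq_one (hq.ne_zero hd.ne') hq4 ?_ ?_ V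
  · split_ifs <;> omega
  · rw [← pow_mul]
    split_ifs with h
    · rw [mul_comm, pow_mul, hq.pow_eq_one, one_pow]
    · rw [Nat.mul_div_cancel' (Nat.not_odd_iff_even.mp h).two_dvd, hq.pow_eq_one]
end
end

section
/- The universal Askey–Wilson algebra △_q is generated as an 𝔽-algebra by A, B and γ. Moreover α = (B²A − (q²+q⁻²)BAB + AB² + (q²−q⁻²)²A + (q−q⁻¹)²Bγ) / ((q−q⁻¹)(q²−q⁻²)) and β = (A²B − (q²+q⁻²)ABA + BA² + (q²−q⁻²)²B + (q−q⁻¹)²Aγ) / ((q−q⁻¹)(q²−q⁻²)). -/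
noncomputable section

/-- In any algebra, if `g = C + s(qAB - pBA)` commutes with `B`, then `A + s(qBC - pCB)` can be
written in terms of `A`, `B` and `g`. -/
theorem awAlpha_aux {𝔽 R : Type*} [Field 𝔽] [Ring R] [Algebra 𝔽 R] {A B C g : R} {q p s : 𝔽}
    (hqp : q * p = 1) (hs : s * (q ^ 2 - p ^ 2) = 1)
    (hg : g = C + s • (q • (A * B) - p • (B * A))) (hc : g * B = B * g) :
    (q + p) • (A + s • (q • (B * C) - p • (C * B))) = ((q + p) * s ^ 2) •
      (B ^ 2 * A - (q ^ 2 + p ^ 2) • (B * A * B) + A * B ^ 2 + (q ^ 2 - p ^ 2) ^ 2 • A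
        + (q - p) ^ 2 • (B * ((q + p) • g))) := by
  have hC : C = g - s • (q • (A * B) - p • (B * A)) := by rw [hg]; abel
  rw [hC]
  simp only [mul_sub, sub_mul, mul_smul_comm, smul_mul_assoc, hc, pow_two B, mul_assoc]
  match_scalars
  · linear_combination (-(q + p) * (s * (q ^ 2 - p ^ 2) + 1)) * hs
  · linear_combination (-(q + p) * s * (q - p)) * hs
  · ring
  · linear_combination ((q + p) * s ^ 2) * hqp
  · linear_combination ((q + p) * s ^ 2) * hqp

/-- In any algebra, if `g = C + s(qAB - pBA)` commutes with `A`, then `B + s(qCA - pAC)` can be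
written in terms of `A`, `B` and `g`. -/
theorem awBeta_aux {𝔽 R : Type*} [Field 𝔽] [Ring R] [Algebra 𝔽 R] {A B C g : R} {q p s : 𝔽}
    (hqp : q * p = 1) (hs : s * (q ^ 2 - p ^ 2) = 1)
    (hg : g = C + s • (q • (A * B) - p • (B * A))) (hc : g * A = A * g) :
    (q + p) • (B + s • (q • (C * A) - p • (A * C))) = ((q + p) * s ^ 2) •
      (A ^ 2 * B - (q ^ 2 + p ^ 2) • (A * B * A) + B * A ^ 2 + (q ^ 2 - p ^ 2) ^ 2 • B
        + (q - p) ^ 2 • (A * ((q + p) • g))) := by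
  have hC : C = g - s • (q • (A * B) - p • (B * A)) := by rw [hg]; abel
  rw [hC]
  simp only [mul_sub, sub_mul, mul_smul_comm, smul_mul_assoc, hc, pow_two A, mul_assoc]
  match_scalars
  · linear_combination (-(q + p) * (s * (q ^ 2 - p ^ 2) + 1)) * hs
  · linear_combination (-(q + p) * s * (q - p)) * hs
  · ring
  · linear_combination ((q + p) * s ^ 2) * hqp
  · linear_combination ((q + p) * s ^ 2) * hqp

/-- The images of the three distinguished elements commute with the generators of `△_q`. -/
theorem awCand_comm (𝔽 : Type*) [Field 𝔽] (q : 𝔽) (i j : Fin 3) :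
    RingQuot.mkAlgHom 𝔽 (awRel 𝔽 q) (awCand 𝔽 q i) * RingQuot.mkAlgHom 𝔽 (awRel 𝔽 q) (awX 𝔽 j) =
      RingQuot.mkAlgHom 𝔽 (awRel 𝔽 q) (awX 𝔽 j) *
        RingQuot.mkAlgHom 𝔽 (awRel 𝔽 q) (awCand 𝔽 q i) := by
  rw [← map_mul, ← map_mul]
  exact RingQuot.mkAlgHom_rel 𝔽 (awRel.comm i j)

/-- `△_q` is generated by `A`, `B` and `C`. -/
theorem uaw_adjoin_A_B_C (𝔽 : Type*) [Field 𝔽] (q : 𝔽) :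
    Algebra.adjoin 𝔽 {awA 𝔽 q, awB 𝔽 q, awC 𝔽 q} = (⊤ : Subalgebra 𝔽 (UAW 𝔽 q)) := by
  rw [← (AlgHom.range_eq_top _).2 (RingQuot.mkAlgHom_surjective 𝔽 (awRel 𝔽 q)),
    ← Algebra.map_top, ← FreeAlgebra.adjoin_range_ι, AlgHom.map_adjoin, ← Set.range_comp]
  congr 1
  ext x
  simp [Fin.exists_fin_succ, awA, awB, awC, awX, eq_comm]

/-- The explicit form of the central element `γ / (q + q⁻¹)` of `△_q`. -/
theorem mkAlgHom_awCand_two (𝔽 : Type*) [Field 𝔽] (q : 𝔽) :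
    RingQuot.mkAlgHom 𝔽 (awRel 𝔽 q) (awCand 𝔽 q 2) = awC 𝔽 q + (q ^ 2 - q⁻¹ ^ 2)⁻¹ •
      (q • (awA 𝔽 q * awB 𝔽 q) - q⁻¹ • (awB 𝔽 q * awA 𝔽 q)) := by
  simp [awCand, awA, awB, awC]

/-- The universal Askey–Wilson algebra `△_q` is generated as an `𝔽`-algebra by
`A`, `B` and `γ`.  Moreover
`α = (B²A − (q²+q⁻²)BAB + AB² + (q²−q⁻²)²A + (q−q⁻¹)²Bγ) / ((q−q⁻¹)(q²−q⁻²))` and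
`β = (A²B − (q²+q⁻²)ABA + BA² + (q²−q⁻²)²B + (q−q⁻¹)²Aγ) / ((q−q⁻¹)(q²−q⁻²))`. -/
theorem uaw_generated_by_A_B_gamma {𝔽 : Type*} [Field 𝔽] [IsAlgClosed 𝔽]
    {d : ℕ} (hd : 0 < d) (hd1 : d ≠ 1) (hd2 : d ≠ 2) (hd4 : d ≠ 4)
    {q : 𝔽} (hq : IsPrimitiveRoot q d) :
    Algebra.adjoin 𝔽 {awA 𝔽 q, awB 𝔽 q, awGamma 𝔽 q} = (⊤ : Subalgebra 𝔽 (UAW 𝔽 q)) ∧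
    awAlpha 𝔽 q = ((q - q⁻¹) * (q ^ 2 - q⁻¹ ^ 2))⁻¹ •
      (awB 𝔽 q ^ 2 * awA 𝔽 q - (q ^ 2 + q⁻¹ ^ 2) • (awB 𝔽 q * awA 𝔽 q * awB 𝔽 q)
        + awA 𝔽 q * awB 𝔽 q ^ 2 + (q ^ 2 - q⁻¹ ^ 2) ^ 2 • awA 𝔽 q
        + (q - q⁻¹) ^ 2 • (awB 𝔽 q * awGamma 𝔽 q)) ∧
    awBeta 𝔽 q = ((q - q⁻¹) * (q ^ 2 - q⁻¹ ^ 2))⁻¹ •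
      (awA 𝔽 q ^ 2 * awB 𝔽 q - (q ^ 2 + q⁻¹ ^ 2) • (awA 𝔽 q * awB 𝔽 q * awA 𝔽 q)
        + awB 𝔽 q * awA 𝔽 q ^ 2 + (q ^ 2 - q⁻¹ ^ 2) ^ 2 • awB 𝔽 q
        + (q - q⁻¹) ^ 2 • (awA 𝔽 q * awGamma 𝔽 q)) := by
  have hq0 : q ≠ 0 := hq.ne_zero hd.ne'
  have hq4 : q ^ 4 ≠ 1 := by
    intro h
    have h4 : d ∣ 4 := hq.dvd_of_pow_eq_one 4 h
    have hle : d ≤ 4 := Nat.le_of_dvd (by norm_num) h4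
    interval_cases d <;> omega
  have hqp : q * q⁻¹ = 1 := mul_inv_cancel₀ hq0
  have hne : q ^ 2 - q⁻¹ ^ 2 ≠ 0 := by
    intro h
    apply hq4
    linear_combination q ^ 2 * h + (q * q⁻¹ + 1) * hqp
  have hfac : q ^ 2 - q⁻¹ ^ 2 = (q - q⁻¹) * (q + q⁻¹) := by ring
  have hk : q + q⁻¹ ≠ 0 := fun h => hne (by rw [hfac, h, mul_zero])
  have hs : (q ^ 2 - q⁻¹ ^ 2)⁻¹ * (q ^ 2 - q⁻¹ ^ 2) = 1 := inv_mul_cancel₀ hne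
  have hcoef : ((q - q⁻¹) * (q ^ 2 - q⁻¹ ^ 2))⁻¹ =
      (q + q⁻¹) * (q ^ 2 - q⁻¹ ^ 2)⁻¹ ^ 2 := by
    refine inv_eq_of_mul_eq_one_right ?_
    generalize (q ^ 2 - q⁻¹ ^ 2)⁻¹ = s at hs ⊢
    linear_combination (s * (q ^ 2 - q⁻¹ ^ 2) + 1) * hs
  refine ⟨?_, ?_, ?_⟩
  · rw [eq_top_iff, ← uaw_adjoin_A_B_C, Algebra.adjoin_le_iff]
    set S := Algebra.adjoin 𝔽 {awA 𝔽 q, awB 𝔽 q, awGamma 𝔽 q}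
    have hA : awA 𝔽 q ∈ S := Algebra.subset_adjoin (by simp)
    have hB : awB 𝔽 q ∈ S := Algebra.subset_adjoin (by simp)
    have hG : awGamma 𝔽 q ∈ S := Algebra.subset_adjoin (by simp)
    have hC : awC 𝔽 q = (q + q⁻¹)⁻¹ • awGamma 𝔽 q - (q ^ 2 - q⁻¹ ^ 2)⁻¹ •
        (q • (awA 𝔽 q * awB 𝔽 q) - q⁻¹ • (awB 𝔽 q * awA 𝔽 q)) := by
      rw [awGamma, inv_smul_smul₀ hk, mkAlgHom_awCand_two, add_sub_cancel_right]
    rintro x (rfl | rfl | rfl)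
    · exact hA
    · exact hB
    · rw [hC]
      exact S.sub_mem (S.smul_mem hG _) (S.smul_mem (S.sub_mem (S.smul_mem (S.mul_mem hA hB) _)
        (S.smul_mem (S.mul_mem hB hA) _)) _)
  · rw [hcoef, awGamma, ← awAlpha_aux hqp hs (mkAlgHom_awCand_two 𝔽 q) (awCand_comm 𝔽 q 2 1)]
    simp [awAlpha, awCand, awA, awB, awC]
  · rw [hcoef, awGamma, ← awBeta_aux hqp hs (mkAlgHom_awCand_two 𝔽 q) (awCand_comm 𝔽 q 2 0)]
    simp [awBeta, awCand, awA, awB, awC]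
end
end

section
/- If V is a finite-dimensional irreducible △_q-module then the dimension of V is less than or equal to √(3đ² − 3đ + 1). -/
noncomputable section

open Polynomial in
/-- The rescaled Chebyshev polynomial `C (n + 1)` is monic of degree `n + 1`. -/
theorem chebyshevC_monic_natDegree (R : Type*) [CommRing R] [Nontrivial R] (n : ℕ) :
    (Polynomial.Chebyshev.C R (n + 1 : ℕ)).Monic ∧
      (Polynomial.Chebyshev.C R (n + 1 : ℕ)).natDegree = n + 1 ∧
      (Polynomial.Chebyshev.C R n).natDegree ≤ n := by
  induction n with
  | zero => simp [show (2 : R[X]) = Polynomial.C 2 from rfl]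
  | succ n ih =>
    obtain ⟨h1, h2, h3⟩ := ih
    have e : Polynomial.Chebyshev.C R (n + 1 + 1 : ℕ)
        = X * Polynomial.Chebyshev.C R (n + 1 : ℕ) - Polynomial.Chebyshev.C R n := by
      have := Polynomial.Chebyshev.C_add_two R n
      push_cast
      rw [← this]
      congr 1
    have hX : (X * Polynomial.Chebyshev.C R (n + 1 : ℕ)).Monic := monic_X.mul h1
    have hd : (X * Polynomial.Chebyshev.C R (n + 1 : ℕ)).natDegree = n + 2 := by
      rw [monic_X.natDegree_mul h1, h2, natDegree_X]; ring
    have hlt : (Polynomial.Chebyshev.C R n).degree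
        < (X * Polynomial.Chebyshev.C R (n + 1 : ℕ)).degree := by
      apply degree_lt_degree
      omega
    refine ⟨?_, ?_, h2.le⟩
    · rw [e]
      exact hX.sub_of_left hlt
    · rw [e, natDegree_sub_eq_left_of_natDegree_lt (by omega), hd]

open Polynomial in
/-- Modulo `Y² - (p + p⁻¹) X Y + X² + (p - p⁻¹)²`, the polynomial `C (n + 1)` evaluated at `Y` is
an explicit linear polynomial in `Y`. -/
theorem dvd_chebyshevC_eval {R : Type*} [CommRing R] (p p' x y : R) (h : p * p' = 1) (n : ℕ) :
    y ^ 2 - (p + p') * x * y + x ^ 2 + (p - p') ^ 2 ∣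
      (p - p') * (Chebyshev.C R (n + 1 : ℕ)).eval y
        - ((p ^ (n + 1) - p' ^ (n + 1)) * (Chebyshev.S R n).eval x * y
          - (p ^ n - p' ^ n) * (Chebyshev.S R (n + 1 : ℕ)).eval x
          - (p ^ (n + 2) - p' ^ (n + 2)) * (Chebyshev.S R (n - 1)).eval x) := by
  induction n using Nat.twoStepInduction with
  | zero => simp
  | one =>
    refine ⟨p - p', ?_⟩
    have h2 : (Chebyshev.C R ((1 + 1 : ℕ) : ℤ)) = X ^ 2 - 2 := by
      rw [← Chebyshev.C_two]; rfl
    have h3 : (Chebyshev.S R ((1 + 1 : ℕ) : ℤ)) = X ^ 2 - 1 := by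
      rw [← Chebyshev.S_two]; rfl
    rw [h2, h3]
    simp
    linear_combination 3 * (p - p') * h
  | more n ih1 ih2 =>
    have hc : (Chebyshev.C R (n + 2 + 1 : ℕ)).eval y =
        y * (Chebyshev.C R (n + 1 + 1 : ℕ)).eval y - (Chebyshev.C R (n + 1 : ℕ)).eval y := by
      have := congrArg (eval y) (Chebyshev.C_add_two R (n + 1))
      simp only [eval_sub, eval_mul, eval_X] at this
      push_cast
      rw [← this]
      ring_nf
    have hs : ∀ k : ℤ, (Chebyshev.S R (k + 2)).eval x =
        x * (Chebyshev.S R (k + 1)).eval x - (Chebyshev.S R k).eval x := by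
      intro k
      have := congrArg (eval x) (Chebyshev.S_add_two R k)
      simpa only [eval_sub, eval_mul, eval_X] using this
    have hs0 := hs (n - 1)
    have hs1 := hs n
    have hs2 := hs (n + 1)
    rw [show (n : ℤ) - 1 + 2 = n + 1 by ring, show (n : ℤ) - 1 + 1 = n by ring] at hs0
    rw [show (n : ℤ) + 1 + 2 = n + 3 by ring, show (n : ℤ) + 1 + 1 = n + 2 by ring] at hs2
    rw [hc]
    push_cast at ih1 ih2 ⊢
    rw [show (n : ℤ) + 2 + 1 = n + 3 by ring, show (n : ℤ) + 2 - 1 = n + 1 by ring]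
    rw [show (n : ℤ) + 1 + 1 = n + 2 by ring, show (n : ℤ) + 1 - 1 = n by ring] at ih2
    rw [show (n : ℤ) + 1 + 1 = n + 2 by ring]
    generalize (Chebyshev.S R (n - 1)).eval x = s0 at *
    generalize (Chebyshev.S R n).eval x = s1 at *
    generalize (Chebyshev.S R (n + 1)).eval x = s2 at *
    generalize (Chebyshev.S R (n + 2)).eval x = s3 at *
    generalize (Chebyshev.S R (n + 3)).eval x = s4 at *
    generalize (Chebyshev.C R (n + 1)).eval y = c1 at *
    generalize (Chebyshev.C R (n + 2)).eval y = c2 at *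
    obtain ⟨u, hu⟩ := ih1
    obtain ⟨v, hv⟩ := ih2
    refine ⟨y * v - u + (p ^ (n + 2) - p' ^ (n + 2)) * s2, ?_⟩
    subst hs2 hs1
    obtain rfl : s0 = x * s1 - s2 := by linear_combination hs0
    simp only [pow_succ] at *
    generalize p ^ n = P at *
    generalize p' ^ n = P' at *
    linear_combination y * hv - hu + (y * x * s2 * (p * P - p' * P') + 2 * s2 * (p ^ 2 * P - p' ^ 2 * P')
      - (P - P') * s2 * (p * p' + 1)) * h

open Polynomial in
/-- When `p ^ (n + 1) = 1`, the polynomial `C (n + 1)` takes congruent values at `X` and `Y`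
modulo `Y² - (p + p⁻¹) X Y + X² + (p - p⁻¹)²`. -/
theorem dvd_chebyshevC_eval_sub {R : Type*} [CommRing R] (p p' k x y : R) (h : p * p' = 1)
    (hk : k * (p - p') = 1) (n : ℕ) (hp : p ^ (n + 1) = 1) :
    y ^ 2 - (p + p') * x * y + x ^ 2 + (p - p') ^ 2 ∣
      (Chebyshev.C R (n + 1 : ℕ)).eval y - (Chebyshev.C R (n + 1 : ℕ)).eval x := by
  have key := dvd_chebyshevC_eval p p' x y h n
  have hp' : p' ^ (n + 1) = 1 := by
    simpa [hp, h] using (mul_pow p p' (n + 1)).symm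
  have e1 : p ^ n = p' := by linear_combination p' * hp - p ^ n * h
  have e2 : p' ^ n = p := by linear_combination p * hp' - p' ^ n * h
  have e3 : p ^ (n + 2) = p := by rw [pow_succ, hp, one_mul]
  have e4 : p' ^ (n + 2) = p' := by rw [pow_succ, hp', one_mul]
  have hC : (Chebyshev.C R (n + 1 : ℕ)).eval x =
      (Chebyshev.S R (n + 1 : ℕ)).eval x - (Chebyshev.S R (n - 1)).eval x := by
    have h1 := congrArg (eval x) (Chebyshev.C_eq_S_sub_X_mul_S R (n + 1))
    have h2 := congrArg (eval x) (Chebyshev.S_add_one R n)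
    simp only [eval_sub, eval_mul, eval_X, eval_ofNat, add_sub_cancel_right] at h1 h2
    push_cast
    linear_combination h1 + h2
  rw [hp, hp', e1, e2, e3, e4] at key
  rw [hC]
  obtain ⟨u, hu⟩ := key
  refine ⟨k * u, ?_⟩
  linear_combination k * hu - ((Chebyshev.C R (n + 1 : ℕ)).eval y
    - ((Chebyshev.S R (n + 1 : ℕ)).eval x - (Chebyshev.S R (n - 1)).eval x)) * hk

/-- A triple of elements of an algebra satisfying the Askey–Wilson relations with
scalar central parameters. -/
structure IsAWTriple_s2 {𝔽 S : Type*} [Field 𝔽] [Ring S] [Algebra 𝔽 S] (q x y z : 𝔽)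
    (a b c : S) : Prop where
  bc : q • (b * c) - q⁻¹ • (c * b) = (q ^ 2 - q⁻¹ ^ 2) • (x • (1 : S) - a)
  ca : q • (c * a) - q⁻¹ • (a * c) = (q ^ 2 - q⁻¹ ^ 2) • (y • (1 : S) - b)
  ab : q • (a * b) - q⁻¹ • (b * a) = (q ^ 2 - q⁻¹ ^ 2) • (z • (1 : S) - c)

namespace IsAWTriple_s2

variable {𝔽 S : Type*} [Field 𝔽] [Ring S] [Algebra 𝔽 S] {q x y z : 𝔽} {a b c : S}

theorem rotate (h : IsAWTriple_s2 q x y z a b c) : IsAWTriple_s2 q y z x b c a :=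
  ⟨h.ca, h.ab, h.bc⟩

theorem ba_eq (h : IsAWTriple_s2 q x y z a b c) (hq : q ≠ 0) :
    b * a = q ^ 2 • (a * b) - (q * (q ^ 2 - q⁻¹ ^ 2)) • (z • (1 : S) - c) := by
  rw [mul_smul q, ← h.ab]
  match_scalars <;> field_simp
  ring

theorem cb_eq (h : IsAWTriple_s2 q x y z a b c) (hq : q ≠ 0) :
    c * b = q ^ 2 • (b * c) - (q * (q ^ 2 - q⁻¹ ^ 2)) • (x • (1 : S) - a) :=
  h.rotate.ba_eq hq

theorem ca_eq (h : IsAWTriple_s2 q x y z a b c) (hq : q ≠ 0) :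
    c * a = (q⁻¹ ^ 2) • (a * c) + (q⁻¹ * (q ^ 2 - q⁻¹ ^ 2)) • (y • (1 : S) - b) := by
  rw [mul_smul q⁻¹, ← h.ca]
  match_scalars <;> field_simp
  ring

theorem ab_eq (h : IsAWTriple_s2 q x y z a b c) (hq : q ≠ 0) :
    a * b = (q⁻¹ ^ 2) • (b * a) + (q⁻¹ * (q ^ 2 - q⁻¹ ^ 2)) • (z • (1 : S) - c) :=
  h.rotate.ca_eq hq

/-- The Casimir element. -/
def casimir (q x y z : 𝔽) (a b c : S) : S :=
  q • (a * (b * c)) + q ^ 2 • (a * a) + q⁻¹ ^ 2 • (b * b) + q ^ 2 • (c * c)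
    - (q * (q + q⁻¹) * x) • a - (q⁻¹ * (q + q⁻¹) * y) • b - (q * (q + q⁻¹) * z) • c

theorem casimir_comm_s2 (h : IsAWTriple_s2 q x y z a b c) (hq : q ≠ 0) :
    Commute (casimir q x y z a b c) a ∧ Commute (casimir q x y z a b c) b ∧
      Commute (casimir q x y z a b c) c := by
  have h1 := h.ba_eq hq
  have h2 := h.cb_eq hq
  have h3 := h.ca_eq hq
  have h1' : ∀ t, b * (a * t) = q ^ 2 • (a * (b * t))
      - (q * (q ^ 2 - q⁻¹ ^ 2)) • (z • t - c * t) := fun t => by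
    rw [← mul_assoc, h1]; simp [sub_mul, mul_assoc]
  have h2' : ∀ t, c * (b * t) = q ^ 2 • (b * (c * t))
      - (q * (q ^ 2 - q⁻¹ ^ 2)) • (x • t - a * t) := fun t => by
    rw [← mul_assoc, h2]; simp [sub_mul, mul_assoc]
  have h3' : ∀ t, c * (a * t) = q⁻¹ ^ 2 • (a * (c * t))
      + (q⁻¹ * (q ^ 2 - q⁻¹ ^ 2)) • (y • t - b * t) := fun t => by
    rw [← mul_assoc, h3]; simp [sub_mul, add_mul, mul_assoc]
  refine ⟨?_, ?_, ?_⟩ <;>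
  · simp only [casimir, Commute, SemiconjBy, add_mul, sub_mul, mul_add, mul_sub, smul_mul_assoc,
      mul_smul_comm, mul_assoc, h1, h1', h2, h2', h3, h3', mul_one]
    match_scalars <;> field_simp <;> ring

/-- The tridiagonal relation between `a` and `b`. -/
theorem cubic (h : IsAWTriple_s2 q x y z a b c) (hq : q ≠ 0) :
    b * (a * a) - (q ^ 2 + q⁻¹ ^ 2) • (a * (b * a)) + a * (a * b)
        + (q ^ 2 - q⁻¹ ^ 2) ^ 2 • b
      = ((q ^ 2 - q⁻¹ ^ 2) ^ 2 * y) • (1 : S)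
        - ((q ^ 2 - q⁻¹ ^ 2) * (q - q⁻¹) * z) • a := by
  have h1 := h.ba_eq hq
  have h3 := h.ca_eq hq
  have h1' : ∀ t, b * (a * t) = q ^ 2 • (a * (b * t))
      - (q * (q ^ 2 - q⁻¹ ^ 2)) • (z • t - c * t) := fun t => by
    rw [← mul_assoc, h1]; simp [sub_mul, mul_assoc]
  simp only [mul_sub, mul_smul_comm, h1, h1', h3, mul_one]
  match_scalars <;> field_simp <;> ring

end IsAWTriple_s2

theorem commute_aeval_self {R S : Type*} [CommRing R] [Ring S] [Algebra R S] (a : S)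
    (f : Polynomial R) : Commute (Polynomial.aeval a f) a := by
  have h := (Commute.all f Polynomial.X).map (Polynomial.aeval a)
  rwa [Polynomial.aeval_X] at h

section BimoduleAction

open Polynomial

variable {𝔽 S : Type*} [Field 𝔽] [Ring S] [Algebra 𝔽 S]

/-- The action of bivariate polynomials on `S` where the inner variable acts as left
multiplication by `a` and the outer one as right multiplication by `a`. -/
def leftRightEval (a : S) : 𝔽[X][X] →+* Module.End 𝔽 S :=
  eval₂RingHom' (aeval (LinearMap.mulLeft 𝔽 a) : 𝔽[X] →ₐ[𝔽] Module.End 𝔽 S).toRingHom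
    (LinearMap.mulRight 𝔽 a) fun f => by
      induction f using Polynomial.induction_on' with
      | add f g hf hg => simpa using hf.add_left hg
      | monomial n r =>
        simp only [AlgHom.toRingHom_eq_coe, RingHom.coe_coe, aeval_monomial]
        exact (Algebra.commute_algebraMap_left r _).mul_left
          ((LinearMap.commute_mulLeft_right a a).pow_left n)

theorem aeval_mulLeft_apply (a t : S) (f : 𝔽[X]) :
    aeval (LinearMap.mulLeft 𝔽 a) f t = aeval a f * t := by
  induction f using Polynomial.induction_on' with
  | add f g hf hg => simp [hf, hg, add_mul]
  | monomial n r => simp [aeval_monomial, LinearMap.pow_mulLeft, Algebra.smul_def, mul_assoc]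

theorem leftRightEval_C (a t : S) (f : 𝔽[X]) :
    leftRightEval a (C f) t = aeval a f * t := by
  simp [leftRightEval, aeval_mulLeft_apply]

theorem leftRightEval_X (a t : S) :
    leftRightEval (𝔽 := 𝔽) a X t = t * a := by
  simp [leftRightEval]

theorem leftRightEval_of_commute (a t : S) (h : Commute a t) (f : 𝔽[X][X]) :
    leftRightEval a f t = aeval a (f.eval X) * t := by
  induction f using Polynomial.induction_on with
  | C f => simp [leftRightEval_C]
  | add f g hf hg => simp [hf, hg, add_mul]
  | monomial n f ih =>
    rw [pow_succ, ← mul_assoc, mul_comm, map_mul, Module.End.mul_apply, ih, leftRightEval_X,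
      mul_comm X, eval_mul (p := C f * X ^ n), map_mul, eval_X, aeval_X, mul_assoc, mul_assoc, h.eq]

theorem leftRightEval_map_C (a t : S) (f : 𝔽[X]) :
    leftRightEval a (f.map C) t = t * aeval a f := by
  induction f using Polynomial.induction_on' with
  | add f g hf hg => simp [hf, hg, mul_add]
  | monomial n r =>
    rw [map_monomial, ← C_mul_X_pow_eq_monomial, map_mul, Module.End.mul_apply, leftRightEval_C,
      map_pow]
    have : leftRightEval (𝔽 := 𝔽) a X = LinearMap.mulRight 𝔽 a := by
      ext t
      simp [leftRightEval_X]
    rw [this, LinearMap.pow_mulRight]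
    simp [aeval_monomial, Algebra.commutes, mul_assoc]

end BimoduleAction

open Polynomial in
/-- The polynomial `C (n + 1)` in `a` commutes with `b` when `q ^ (2 (n + 1)) = 1`. -/
theorem IsAWTriple_s2.commute_aeval_chebyshevC {𝔽 S : Type*} [Field 𝔽] [Ring S] [Algebra 𝔽 S]
    {q x y z : 𝔽} {a b c : S} (h : IsAWTriple_s2 q x y z a b c) (hq : q ≠ 0)
    (hq2 : q ^ 2 - q⁻¹ ^ 2 ≠ 0) {n : ℕ} (hn : (q ^ 2) ^ (n + 1) = 1) :
    Commute (aeval a (Chebyshev.C 𝔽 (n + 1 : ℕ))) b := by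
  set κ := q ^ 2 - q⁻¹ ^ 2 with hκ
  have hpp : q ^ 2 * q⁻¹ ^ 2 = 1 := by field_simp
  set f := Chebyshev.C 𝔽 (n + 1 : ℕ) with hf
  obtain ⟨g, hg⟩ := dvd_chebyshevC_eval_sub (C (C (q ^ 2))) (C (C (q⁻¹ ^ 2))) (C (C κ⁻¹))
    (C X : 𝔽[X][X]) X (by rw [← C_mul, ← C_mul, hpp]; simp)
    (by rw [← C_sub, ← C_sub, ← C_mul, ← C_mul, inv_mul_cancel₀ hq2]; simp) n
    (by rw [← C_pow, ← C_pow, hn]; simp)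
  have ev1 : (Chebyshev.C 𝔽[X][X] (n + 1 : ℕ)).eval X = f.map C := by
    rw [← Chebyshev.aeval_C (R := 𝔽), ← hf, aeval_def, map, IsScalarTower.algebraMap_eq 𝔽 𝔽[X]]
    rfl
  have ev2 : (Chebyshev.C 𝔽[X][X] (n + 1 : ℕ)).eval (C X) = C f := by
    rw [← Chebyshev.aeval_C (R := 𝔽), ← hf]
    simpa using aeval_algHom_apply (CAlgHom (R := 𝔽) (A := 𝔽[X])) X f
  rw [ev1, ev2] at hg
  have hg0 : g.eval X = 0 := by
    have := congrArg (eval X) hg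
    simp only [eval_sub, eval_map, eval_C, eval_mul, eval_add, eval_pow, eval_X] at this
    rw [eval₂_C_X, sub_self, eq_comm, mul_eq_zero] at this
    refine this.resolve_left fun h0 => hq2 ?_
    have := congrArg (eval 0) h0
    simpa [hκ] using this
  have hQ := h.cubic hq
  have hL := congrArg (fun φ => leftRightEval a φ b) hg
  simp only [map_sub, LinearMap.sub_apply, leftRightEval_map_C, leftRightEval_C] at hL
  rw [mul_comm, map_mul, Module.End.mul_apply] at hL
  have hQb : leftRightEval a (X ^ 2 - (C (C (q ^ 2)) + C (C (q⁻¹ ^ 2))) * C X * X + C X ^ 2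
      + (C (C (q ^ 2)) - C (C (q⁻¹ ^ 2))) ^ 2) b
      = (κ ^ 2 * y) • (1 : S) - (κ * (q - q⁻¹) * z) • a := by
    rw [← hQ, ← C_add, ← C_add, ← C_sub, ← C_sub, ← hκ]
    simp only [pow_two, map_add, map_sub, map_mul, LinearMap.add_apply, LinearMap.sub_apply,
      Module.End.mul_apply, leftRightEval_X, leftRightEval_C, aeval_C, aeval_X]
    simp [Algebra.smul_def, mul_assoc, add_mul]
  rw [hQb, leftRightEval_of_commute _ _ _ g, hg0] at hL
  · simp only [map_zero, zero_mul] at hL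
    exact (sub_eq_zero.mp hL).symm
  · exact ((Commute.one_right a).smul_right _).sub_right ((Commute.refl a).smul_right _)

open Polynomial in
/-- The polynomial `C (n + 1)` in `a` commutes with `c` when `q ^ (2 (n + 1)) = 1`. -/
theorem IsAWTriple_s2.commute_aeval_chebyshevC' {𝔽 S : Type*} [Field 𝔽] [Ring S] [Algebra 𝔽 S]
    {q x y z : 𝔽} {a b c : S} (h : IsAWTriple_s2 q x y z a b c) (hq : q ≠ 0)
    (hq2 : q ^ 2 - q⁻¹ ^ 2 ≠ 0) {n : ℕ} (hn : (q ^ 2) ^ (n + 1) = 1) :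
    Commute (aeval a (Chebyshev.C 𝔽 (n + 1 : ℕ))) c := by
  have hb := h.commute_aeval_chebyshevC hq hq2 hn
  set t := aeval a (Chebyshev.C 𝔽 (n + 1 : ℕ))
  have ha : Commute t a := commute_aeval_self a _
  have hc : c = z • (1 : S) - (q ^ 2 - q⁻¹ ^ 2)⁻¹ • (q • (a * b) - q⁻¹ • (b * a)) := by
    rw [h.ab, smul_smul, inv_mul_cancel₀ hq2, one_smul, sub_sub_cancel]
  rw [hc]
  exact ((Commute.one_right t).smul_right _).sub_right
    ((((ha.mul_right hb).smul_right _).sub_right ((hb.mul_right ha).smul_right _)).smul_right _)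

section Spanning

variable {𝔽 S : Type*} [Field 𝔽] [Ring S] [Algebra 𝔽 S]

/-- If `u v` and `v u` agree up to a scalar modulo `M`, then so do `u vⁱ` and `vⁱ u`
modulo `Mⁱ`. -/
theorem mul_pow_sub_smul_mem {M : Submodule 𝔽 S} {u v : S} {s : 𝔽} (hv : v ∈ M)
    (h : u * v - s • (v * u) ∈ M) (i : ℕ) :
    u * v ^ i - s ^ i • (v ^ i * u) ∈ M ^ i := by
  induction i with
  | zero => simp
  | succ i ih =>
    have e : u * v ^ (i + 1) - s ^ (i + 1) • (v ^ (i + 1) * u)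
        = (u * v ^ i - s ^ i • (v ^ i * u)) * v + s ^ i • (v ^ i * (u * v - s • (v * u))) := by
      simp only [pow_succ, mul_smul, sub_mul, mul_sub, smul_sub, mul_assoc, smul_mul_assoc,
        mul_smul_comm]
      abel
    rw [e, pow_succ]
    exact add_mem (Submodule.mul_mem_mul ih hv)
      (Submodule.smul_mem _ _ (Submodule.mul_mem_mul (Submodule.pow_mem_pow _ hv i) h))

theorem aeval_mem_pow {M : Submodule 𝔽 S} (h1 : 1 ≤ M) {a : S} (ha : a ∈ M) {p : Polynomial 𝔽}
    {n : ℕ} (hp : p.natDegree ≤ n) : Polynomial.aeval a p ∈ M ^ n := by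
  rw [Polynomial.aeval_eq_sum_range]
  refine Submodule.sum_mem _ fun i hi => Submodule.smul_mem _ _ ?_
  have : i ≤ n := by rw [Finset.mem_range] at hi; omega
  exact pow_le_pow_right₀ h1 this (Submodule.pow_mem_pow _ ha i)

/-- If the polynomial `C (n + 1)` takes a scalar value at `a`, high powers of `a` can be
reduced. -/
theorem pow_mem_pow_pred {M : Submodule 𝔽 S} (h1 : 1 ≤ M) {a : S} (ha : a ∈ M) {n : ℕ} {t : 𝔽}
    (h : Polynomial.aeval a (Polynomial.Chebyshev.C 𝔽 (n + 1 : ℕ)) = t • (1 : S)) {i : ℕ}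
    (hi : n + 1 ≤ i) : a ^ i ∈ M ^ (i - 1) := by
  obtain ⟨hm, hd, -⟩ := chebyshevC_monic_natDegree 𝔽 n
  set f := Polynomial.Chebyshev.C 𝔽 (n + 1 : ℕ)
  have hf := f.eraseLead_add_monomial_natDegree_leadingCoeff
  rw [hm.leadingCoeff, hd] at hf
  have hone : (1 : S) ∈ M ^ n := Submodule.one_le.mp (one_le_pow₀ h1)
  have h2 : a ^ (n + 1) ∈ M ^ n := by
    have : a ^ (n + 1) = t • (1 : S) - Polynomial.aeval a f.eraseLead := by
      rw [← h, eq_sub_iff_add_eq', ← congrArg (Polynomial.aeval a) hf, map_add,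
        Polynomial.aeval_monomial, map_one, one_mul]
    rw [this]
    refine sub_mem (Submodule.smul_mem _ _ hone) (aeval_mem_pow h1 ha ?_)
    have := f.eraseLead_natDegree_le
    omega
  obtain ⟨j, rfl⟩ := Nat.exists_eq_add_of_le hi
  rw [show n + 1 + j - 1 = n + j by omega, pow_add, pow_add]
  exact Submodule.mul_mem_mul h2 (Submodule.pow_mem_pow _ ha j)

/-- The linear span of `1, a, b, c`. -/
def wordSpan (𝔽 : Type*) {S : Type*} [Field 𝔽] [Ring S] [Algebra 𝔽 S] (a b c : S) :
    Submodule 𝔽 S :=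
  Submodule.span 𝔽 {1, a, b, c}

namespace IsAWTriple_s2

variable {q x y z : 𝔽} {a b c : S}

theorem one_le_wordSpan (a b c : S) : 1 ≤ wordSpan 𝔽 a b c :=
  Submodule.one_le.mpr (Submodule.subset_span (by simp))

theorem wordSpan_gens (a b c : S) :
    a ∈ wordSpan 𝔽 a b c ∧ b ∈ wordSpan 𝔽 a b c ∧ c ∈ wordSpan 𝔽 a b c :=
  ⟨Submodule.subset_span (by simp), Submodule.subset_span (by simp),
    Submodule.subset_span (by simp)⟩

theorem smul_one_mem_wordSpan (a b c : S) (t : 𝔽) : t • (1 : S) ∈ wordSpan 𝔽 a b c :=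
  Submodule.smul_mem _ _ (Submodule.subset_span (by simp))

theorem ba_mem (h : IsAWTriple_s2 q x y z a b c) (hq : q ≠ 0) :
    b * a - q ^ 2 • (a * b) ∈ wordSpan 𝔽 a b c := by
  rw [h.ba_eq hq, sub_sub_cancel_left]
  exact neg_mem (Submodule.smul_mem _ _
    (sub_mem (smul_one_mem_wordSpan a b c z) (wordSpan_gens a b c).2.2))

theorem cb_mem (h : IsAWTriple_s2 q x y z a b c) (hq : q ≠ 0) :
    c * b - q ^ 2 • (b * c) ∈ wordSpan 𝔽 a b c := by
  rw [h.cb_eq hq, sub_sub_cancel_left]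
  exact neg_mem (Submodule.smul_mem _ _
    (sub_mem (smul_one_mem_wordSpan a b c x) (wordSpan_gens a b c).1))

theorem ca_mem (h : IsAWTriple_s2 q x y z a b c) (hq : q ≠ 0) :
    c * a - q⁻¹ ^ 2 • (a * c) ∈ wordSpan 𝔽 a b c := by
  rw [h.ca_eq hq, add_sub_cancel_left]
  exact Submodule.smul_mem _ _
    (sub_mem (smul_one_mem_wordSpan a b c y) (wordSpan_gens a b c).2.1)

theorem ab_mem (h : IsAWTriple_s2 q x y z a b c) (hq : q ≠ 0) :
    a * b - q⁻¹ ^ 2 • (b * a) ∈ wordSpan 𝔽 a b c := by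
  rw [h.ab_eq hq, add_sub_cancel_left]
  exact Submodule.smul_mem _ _
    (sub_mem (smul_one_mem_wordSpan a b c z) (wordSpan_gens a b c).2.2)

/-- Modulo words of smaller length, words of length `N + 1` are spanned by ordered monomials. -/
theorem wordSpan_pow_succ_le (h : IsAWTriple_s2 q x y z a b c) (hq : q ≠ 0) (N : ℕ) :
    wordSpan 𝔽 a b c ^ (N + 1) ≤ wordSpan 𝔽 a b c ^ N ⊔
      Submodule.span 𝔽 {m | ∃ i j k, i + j + k = N + 1 ∧ m = a ^ i * b ^ j * c ^ k} := by
  obtain ⟨ha, hb, hc⟩ := wordSpan_gens (𝔽 := 𝔽) a b c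
  have hba := h.ba_mem hq
  have hcb := h.cb_mem hq
  have hca := h.ca_mem hq
  induction N with
  | zero =>
    rw [zero_add, pow_one, pow_zero, wordSpan, Submodule.span_le]
    rintro m (rfl | rfl | rfl | rfl)
    · exact Submodule.mem_sup_left (Submodule.one_le.mp le_rfl)
    · exact Submodule.mem_sup_right (Submodule.subset_span ⟨1, 0, 0, by simp⟩)
    · exact Submodule.mem_sup_right (Submodule.subset_span ⟨0, 1, 0, by simp⟩)
    · exact Submodule.mem_sup_right (Submodule.subset_span ⟨0, 0, 1, by simp⟩)
  | succ N ih =>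
    set M := wordSpan 𝔽 a b c with hM
    rw [pow_succ' M (N + 1)]
    refine (mul_le_mul' le_rfl ih).trans ?_
    rw [Submodule.mul_sup, ← pow_succ']
    refine sup_le le_sup_left ?_
    nth_rw 1 [hM]
    rw [wordSpan, Submodule.span_mul_span, Submodule.span_le]
    rintro _ ⟨g, hg, _, ⟨i, j, k, hijk, rfl⟩, rfl⟩
    have hai := Submodule.pow_mem_pow M ha i
    have hbj := Submodule.pow_mem_pow M hb j
    have hck := Submodule.pow_mem_pow M hc k
    have hmon : ∀ i j k : ℕ, i + j + k = N + 1 + 1 → a ^ i * b ^ j * c ^ k ∈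
        Submodule.span 𝔽 {m | ∃ i j k, i + j + k = N + 1 + 1 ∧ m = a ^ i * b ^ j * c ^ k} :=
      fun i j k e => Submodule.subset_span ⟨i, j, k, e, rfl⟩
    have hpow : M ^ (N + 1) = M ^ i * M ^ j * M ^ k := by rw [← pow_add, ← pow_add, hijk]
    simp only [SetLike.mem_coe]
    rcases hg with rfl | rfl | rfl | rfl
    · refine Submodule.mem_sup_left ?_
      rw [one_mul, hpow]
      exact Submodule.mul_mem_mul (Submodule.mul_mem_mul hai hbj) hck
    · refine Submodule.mem_sup_right ?_
      simpa only [pow_succ', mul_assoc] using hmon (i + 1) j k (by omega)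
    · have e : g * (a ^ i * g ^ j * c ^ k) =
          (g * a ^ i - (q ^ 2) ^ i • (a ^ i * g)) * g ^ j * c ^ k
            + (q ^ 2) ^ i • (a ^ i * g ^ (j + 1) * c ^ k) := by
        simp only [sub_mul, smul_mul_assoc, pow_succ', mul_assoc]
        abel
      simp only [e]
      refine Submodule.add_mem_sup ?_ (Submodule.smul_mem _ _ (hmon i (j + 1) k (by omega)))
      rw [hpow]
      exact Submodule.mul_mem_mul (Submodule.mul_mem_mul (mul_pow_sub_smul_mem ha hba i) hbj) hck
    · have e : g * (a ^ i * b ^ j * g ^ k) =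
          ((g * a ^ i - (q⁻¹ ^ 2) ^ i • (a ^ i * g)) * b ^ j * g ^ k
            + (q⁻¹ ^ 2) ^ i • (a ^ i * (g * b ^ j - (q ^ 2) ^ j • (b ^ j * g)) * g ^ k))
            + ((q⁻¹ ^ 2) ^ i * (q ^ 2) ^ j) • (a ^ i * b ^ j * g ^ (k + 1)) := by
        simp only [sub_mul, mul_sub, smul_sub, smul_mul_assoc, mul_smul_comm, pow_succ', mul_assoc,
          mul_smul]
        abel
      simp only [e]
      refine Submodule.add_mem_sup ?_ (Submodule.smul_mem _ _ (hmon i j (k + 1) (by omega)))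
      rw [hpow]
      exact add_mem
        (Submodule.mul_mem_mul (Submodule.mul_mem_mul (mul_pow_sub_smul_mem ha hca i) hbj) hck)
        (Submodule.smul_mem _ _ (Submodule.mul_mem_mul
          (Submodule.mul_mem_mul hai (mul_pow_sub_smul_mem hb hcb j)) hck))

/-- If the Casimir element is a scalar, then `a b c` lies in the span of words of length two. -/
theorem abc_mem (hq : q ≠ 0) {w : 𝔽} (hw : casimir q x y z a b c = w • (1 : S)) :
    a * (b * c) ∈ wordSpan 𝔽 a b c ^ 2 := by
  have h1 := one_le_wordSpan (𝔽 := 𝔽) a b c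
  obtain ⟨ha, hb, hc⟩ := wordSpan_gens (𝔽 := 𝔽) a b c
  set M := wordSpan 𝔽 a b c
  have hle : M ≤ M ^ 2 := le_self_pow₀ h1 two_ne_zero
  have h2 : ∀ {u}, u ∈ M → u * u ∈ M ^ 2 := fun hu => pow_two M ▸ Submodule.mul_mem_mul hu hu
  have e : a * (b * c) = q⁻¹ • (w • (1 : S) - q ^ 2 • (a * a) - q⁻¹ ^ 2 • (b * b) - q ^ 2 • (c * c)
    + (q * (q + q⁻¹) * x) • a + (q⁻¹ * (q + q⁻¹) * y) • b + (q * (q + q⁻¹) * z) • c) := by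
    rw [← hw, casimir]
    match_scalars <;> field_simp <;> ring
  rw [e]
  have := hle (smul_one_mem_wordSpan a b c w)
  have := h2 ha
  have := h2 hb
  have := h2 hc
  have := hle ha
  have := hle hb
  have := hle hc
  refine Submodule.smul_mem _ _ ?_
  repeat' first | assumption | apply add_mem | apply sub_mem | apply Submodule.smul_mem

/-- The span of the reduced ordered monomials contains all words. -/
theorem wordSpan_pow_le (h : IsAWTriple_s2 q x y z a b c) (hq : q ≠ 0) {w : 𝔽}
    (hw : casimir q x y z a b c = w • (1 : S)) {n : ℕ} {ta tb tc : 𝔽}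
    (hta : Polynomial.aeval a (Polynomial.Chebyshev.C 𝔽 (n + 1 : ℕ)) = ta • (1 : S))
    (htb : Polynomial.aeval b (Polynomial.Chebyshev.C 𝔽 (n + 1 : ℕ)) = tb • (1 : S))
    (htc : Polynomial.aeval c (Polynomial.Chebyshev.C 𝔽 (n + 1 : ℕ)) = tc • (1 : S)) (N : ℕ) :
    wordSpan 𝔽 a b c ^ N ≤ Submodule.span 𝔽 {m | ∃ i j k, i < n + 1 ∧ j < n + 1 ∧ k < n + 1 ∧
      (i = 0 ∨ j = 0 ∨ k = 0) ∧ m = a ^ i * b ^ j * c ^ k} := by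
  have h1 := one_le_wordSpan (𝔽 := 𝔽) a b c
  obtain ⟨ha, hb, hc⟩ := wordSpan_gens (𝔽 := 𝔽) a b c
  have hab := h.ab_mem hq
  have habc := abc_mem hq hw
  induction N with
  | zero =>
    rw [pow_zero, Submodule.one_le]
    exact Submodule.subset_span ⟨0, 0, 0, by simp⟩
  | succ N ih =>
    refine (h.wordSpan_pow_succ_le hq N).trans (sup_le ih (Submodule.span_le.mpr ?_))
    rintro _ ⟨i, j, k, hijk, rfl⟩
    set M := wordSpan 𝔽 a b c
    have hai := Submodule.pow_mem_pow M ha i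
    have hbj := Submodule.pow_mem_pow M hb j
    have hck := Submodule.pow_mem_pow M hc k
    by_cases hi : n + 1 ≤ i
    · refine ih ?_
      rw [show N = (i - 1) + j + k by omega, pow_add, pow_add]
      exact Submodule.mul_mem_mul (Submodule.mul_mem_mul (pow_mem_pow_pred h1 ha hta hi) hbj) hck
    by_cases hj : n + 1 ≤ j
    · refine ih ?_
      rw [show N = i + (j - 1) + k by omega, pow_add, pow_add]
      exact Submodule.mul_mem_mul (Submodule.mul_mem_mul hai (pow_mem_pow_pred h1 hb htb hj)) hck
    by_cases hk : n + 1 ≤ k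
    · refine ih ?_
      rw [show N = i + j + (k - 1) by omega, pow_add, pow_add]
      exact Submodule.mul_mem_mul (Submodule.mul_mem_mul hai hbj) (pow_mem_pow_pred h1 hc htc hk)
    by_cases h0 : i = 0 ∨ j = 0 ∨ k = 0
    · exact Submodule.subset_span
        ⟨i, j, k, by omega, by omega, by omega, h0, rfl⟩
    · push Not at h0
      obtain ⟨i, rfl⟩ := Nat.exists_eq_succ_of_ne_zero h0.1
      obtain ⟨j, rfl⟩ := Nat.exists_eq_succ_of_ne_zero h0.2.1
      obtain ⟨k, rfl⟩ := Nat.exists_eq_succ_of_ne_zero h0.2.2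
      refine ih ?_
      have e : a ^ (i + 1) * b ^ (j + 1) * c ^ (k + 1) =
          a ^ i * ((a * b ^ j - (q⁻¹ ^ 2) ^ j • (b ^ j * a)) * (b * c)
            + (q⁻¹ ^ 2) ^ j • (b ^ j * (a * (b * c)))) * c ^ k := by
        rw [pow_succ a, pow_succ b, pow_succ' c]
        simp only [sub_mul, mul_sub, mul_add, add_mul, smul_mul_assoc, mul_smul_comm, mul_assoc]
        abel
      simp only [Nat.succ_eq_add_one, e]
      rw [show N = i + (j + 2) + k by omega, pow_add, pow_add _ i, pow_add _ j]
      refine Submodule.mul_mem_mul (Submodule.mul_mem_mul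
        (Submodule.pow_mem_pow M ha i) (add_mem ?_ (Submodule.smul_mem _ _ ?_)))
        (Submodule.pow_mem_pow M hc k)
      · exact Submodule.mul_mem_mul (mul_pow_sub_smul_mem hb hab j)
          (pow_two M ▸ Submodule.mul_mem_mul hb hc)
      · exact Submodule.mul_mem_mul (Submodule.pow_mem_pow M hb j) habc

/-- The span of the reduced ordered monomials has dimension at most `3 n² + 3 n + 1`. -/
theorem finrank_span_monomials_le (a b c : S) (n : ℕ) :
    Module.finrank 𝔽 (Submodule.span 𝔽 {m : S | ∃ i j k, i < n + 1 ∧ j < n + 1 ∧ k < n + 1 ∧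
      (i = 0 ∨ j = 0 ∨ k = 0) ∧ m = a ^ i * b ^ j * c ^ k}) ≤ 3 * n ^ 2 + 3 * n + 1 := by
  classical
  let R := Finset.range (n + 1)
  let P := (Finset.range n).image Nat.succ
  let T : Finset (ℕ × ℕ × ℕ) := (R ×ˢ R ×ˢ R) \ (P ×ˢ P ×ˢ P)
  have hP : P.card = n := by
    rw [Finset.card_image_of_injective _ Nat.succ_injective, Finset.card_range]
  have hPR : P ⊆ R := by
    intro i
    simp only [P, R, Finset.mem_image, Finset.mem_range]
    omega
  have hmemP : ∀ i, i ∈ P ↔ i ≠ 0 ∧ i < n + 1 := by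
    intro i
    simp only [P, Finset.mem_image, Finset.mem_range]
    exact ⟨by omega, fun hi => ⟨i - 1, by omega, by omega⟩⟩
  have hT : T.card = 3 * n ^ 2 + 3 * n + 1 := by
    rw [Finset.card_sdiff_of_subset
      (Finset.product_subset_product hPR (Finset.product_subset_product hPR hPR))]
    simp only [Finset.card_product, hP, R, Finset.card_range]
    rw [Nat.sub_eq_iff_eq_add (by gcongr <;> omega)]
    ring
  have hset : {m : S | ∃ i j k, i < n + 1 ∧ j < n + 1 ∧ k < n + 1 ∧
      (i = 0 ∨ j = 0 ∨ k = 0) ∧ m = a ^ i * b ^ j * c ^ k}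
      = (T.image fun t => a ^ t.1 * b ^ t.2.1 * c ^ t.2.2 : Finset S) := by
    ext m
    simp only [Set.mem_ofPred_eq, Finset.coe_image, Set.mem_image, Finset.mem_coe, Prod.exists, T,
      Finset.mem_sdiff, Finset.mem_product, hmemP, R, Finset.mem_range]
    constructor
    · rintro ⟨i, j, k, hi, hj, hk, h0, rfl⟩
      exact ⟨i, j, k, ⟨⟨hi, hj, hk⟩, by omega⟩, rfl⟩
    · rintro ⟨i, j, k, ⟨⟨hi, hj, hk⟩, h0⟩, rfl⟩
      exact ⟨i, j, k, hi, hj, hk, by omega, rfl⟩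
  rw [hset, ← hT]
  exact (finrank_span_finset_le_card _).trans Finset.card_image_le

end IsAWTriple_s2

end Spanning

section Representation

variable {𝔽 : Type*} [Field 𝔽] {q : 𝔽} (V : Type*) [AddCommGroup V] [Module 𝔽 V]
  [Module (UAW 𝔽 q) V] [IsScalarTower 𝔽 (UAW 𝔽 q) V]

/-- The representation `△_q → End V` afforded by a `△_q`-module `V`. -/
def uawRep (𝔽 : Type*) [Field 𝔽] (q : 𝔽) (V : Type*) [AddCommGroup V] [Module 𝔽 V]
    [Module (UAW 𝔽 q) V] [IsScalarTower 𝔽 (UAW 𝔽 q) V] :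
    UAW 𝔽 q →ₐ[𝔽] Module.End 𝔽 V :=
  Algebra.lsmul 𝔽 𝔽 V

theorem uaw_induction {p : UAW 𝔽 q → Prop} (scalar : ∀ r, p (algebraMap 𝔽 _ r))
    (hA : p (awA 𝔽 q)) (hB : p (awB 𝔽 q)) (hC : p (awC 𝔽 q))
    (add : ∀ u v, p u → p v → p (u + v)) (mul : ∀ u v, p u → p v → p (u * v))
    (u : UAW 𝔽 q) : p u := by
  obtain ⟨f, rfl⟩ := RingQuot.mkAlgHom_surjective 𝔽 (awRel 𝔽 q) u
  induction f using FreeAlgebra.induction with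
  | grade0 r => simpa using scalar r
  | grade1 i =>
    fin_cases i
    exacts [hA, hB, hC]
  | mul f g hf hg => simpa using mul _ _ hf hg
  | add f g hf hg => simpa using add _ _ hf hg

/-- Schur's lemma: an operator commuting with the generators is a scalar. -/
theorem exists_eq_smul_one_of_commute [IsAlgClosed 𝔽] [FiniteDimensional 𝔽 V]
    [IsSimpleModule (UAW 𝔽 q) V] (t : Module.End 𝔽 V)
    (hA : Commute t (uawRep 𝔽 q V (awA 𝔽 q))) (hB : Commute t (uawRep 𝔽 q V (awB 𝔽 q)))
    (hC : Commute t (uawRep 𝔽 q V (awC 𝔽 q))) : ∃ w : 𝔽, t = w • (1 : Module.End 𝔽 V) := by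
  have h : ∀ u, Commute t (uawRep 𝔽 q V u) := by
    intro u
    induction u using uaw_induction with
    | scalar r => rw [AlgHom.commutes]; exact Algebra.commute_algebraMap_right r t
    | hA => exact hA
    | hB => exact hB
    | hC => exact hC
    | add u v hu hv => rw [map_add]; exact hu.add_right hv
    | mul u v hu hv => rw [map_mul]; exact hu.mul_right hv
  let T : Module.End (UAW 𝔽 q) V :=
    { t with map_smul' := fun u v => LinearMap.congr_fun (h u) v }
  obtain ⟨w, hw⟩ := (IsSimpleModule.algebraMap_end_bijective_of_isAlgClosed (A := UAW 𝔽 q)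
    (V := V) 𝔽).2 T
  refine ⟨w, LinearMap.ext fun v => ?_⟩
  exact (LinearMap.congr_fun hw v).symm

/-- Burnside's theorem: an irreducible representation is surjective onto `End V`. -/
theorem uawRep_surjective [IsAlgClosed 𝔽] [FiniteDimensional 𝔽 V] [IsSimpleModule (UAW 𝔽 q) V] :
    Function.Surjective (uawRep 𝔽 q V) := by
  intro f
  let F : Module.End (Module.End (UAW 𝔽 q) V) V :=
    { f with
      map_smul' := fun T v => by
        obtain ⟨w, rfl⟩ := (IsSimpleModule.algebraMap_end_bijective_of_isAlgClosed
          (A := UAW 𝔽 q) (V := V) 𝔽).2 T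
        exact f.map_smul w v }
  obtain ⟨s, hs⟩ := (inferInstance : Module.Finite 𝔽 V).fg_top
  obtain ⟨r, hr⟩ := jacobson_density F s
  exact ⟨r, LinearMap.ext_on hs fun m hm => (hr m hm).symm⟩

theorem awCand_commute (i : Fin 3) (u : UAW 𝔽 q) :
    Commute (RingQuot.mkAlgHom 𝔽 (awRel 𝔽 q) (awCand 𝔽 q i)) u := by
  have h : ∀ j, Commute (RingQuot.mkAlgHom 𝔽 (awRel 𝔽 q) (awCand 𝔽 q i))
      (RingQuot.mkAlgHom 𝔽 (awRel 𝔽 q) (awX 𝔽 j)) := fun j => by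
    have := RingQuot.mkAlgHom_rel 𝔽 (awRel.comm (q := q) i j)
    rwa [map_mul, map_mul] at this
  induction u using uaw_induction with
  | scalar r => exact Algebra.commute_algebraMap_right r _
  | hA => exact h 0
  | hB => exact h 1
  | hC => exact h 2
  | add u v hu hv => exact hu.add_right hv
  | mul u v hu hv => exact hu.mul_right hv

/-- On an irreducible module the generators act by a triple satisfying the Askey–Wilson relations
with scalar parameters. -/
theorem exists_isAWTriple [IsAlgClosed 𝔽] [FiniteDimensional 𝔽 V] [IsSimpleModule (UAW 𝔽 q) V]
    (hq2 : q ^ 2 - q⁻¹ ^ 2 ≠ 0) : ∃ x y z : 𝔽, IsAWTriple_s2 q x y z (uawRep 𝔽 q V (awA 𝔽 q))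
      (uawRep 𝔽 q V (awB 𝔽 q)) (uawRep 𝔽 q V (awC 𝔽 q)) := by
  have h : ∀ i, ∃ w : 𝔽, uawRep 𝔽 q V (RingQuot.mkAlgHom 𝔽 (awRel 𝔽 q) (awCand 𝔽 q i))
      = w • (1 : Module.End 𝔽 V) := fun i =>
    exists_eq_smul_one_of_commute (q := q) V _ ((awCand_commute i _).map _)
      ((awCand_commute i _).map _) ((awCand_commute i _).map _)
  have key : ∀ {u v : Module.End 𝔽 V} {w : 𝔽}, u + (q ^ 2 - q⁻¹ ^ 2)⁻¹ • v = w • 1 →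
      v = (q ^ 2 - q⁻¹ ^ 2) • (w • (1 : Module.End 𝔽 V) - u) := fun e => by
    rw [← e, add_sub_cancel_left, smul_smul, mul_inv_cancel₀ hq2, one_smul]
  obtain ⟨x, hx⟩ := h 0
  obtain ⟨y, hy⟩ := h 1
  obtain ⟨z, hz⟩ := h 2
  simp only [awCand, map_add, map_smul, map_sub, map_mul] at hx hy hz
  exact ⟨x, y, z, key hx, key hy, key hz⟩

end Representation

/-- If `V` is a finite-dimensional irreducible `△_q`-module then the dimension of
`V` is at most `√(3đ² − 3đ + 1)`, where `đ = d` if `d` is odd and `đ = d/2` if `d`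
is even. -/
theorem uaw_finrank_le_sqrt {𝔽 : Type*} [Field 𝔽] [IsAlgClosed 𝔽]
    {d : ℕ} (hd : 0 < d) (hd1 : d ≠ 1) (hd2 : d ≠ 2) (hd4 : d ≠ 4)
    {q : 𝔽} (hq : IsPrimitiveRoot q d)
    (dd : ℕ) (hdd : dd = if Odd d then d else d / 2)
    (V : Type*) [AddCommGroup V] [Module 𝔽 V] [Module (UAW 𝔽 q) V]
    [IsScalarTower 𝔽 (UAW 𝔽 q) V] [FiniteDimensional 𝔽 V]
    [IsSimpleModule (UAW 𝔽 q) V] :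
    (Module.finrank 𝔽 V : ℝ) ≤ Real.sqrt (3 * (dd : ℝ) ^ 2 - 3 * (dd : ℝ) + 1) := by
  have hq0 : q ≠ 0 := hq.ne_zero hd.ne'
  have hd8 : ¬ d ∣ 4 := fun h => by
    have := Nat.le_of_dvd (by norm_num) h
    interval_cases d <;> omega
  have hq2 : q ^ 2 - q⁻¹ ^ 2 ≠ 0 := by
    intro h
    refine hd8 (hq.dvd_of_pow_eq_one 4 ?_)
    field_simp at h
    linear_combination h
  have hdvd : d ∣ 2 * dd ∧ 0 < dd := by
    rw [hdd]
    split_ifs with ho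
    · exact ⟨dvd_mul_left d 2, hd⟩
    · rw [Nat.not_odd_iff_even] at ho
      obtain ⟨m, rfl⟩ := ho
      exact ⟨⟨1, by omega⟩, by omega⟩
  obtain ⟨n, rfl⟩ := Nat.exists_eq_succ_of_ne_zero hdvd.2.ne'
  have hn : (q ^ 2) ^ (n + 1) = 1 := by
    rw [← pow_mul, hq.pow_eq_one_iff_dvd]
    exact hdvd.1
  obtain ⟨x, y, z, h⟩ := exists_isAWTriple (q := q) V hq2
  set a := uawRep 𝔽 q V (awA 𝔽 q)
  set b := uawRep 𝔽 q V (awB 𝔽 q)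
  set c := uawRep 𝔽 q V (awC 𝔽 q)
  have schur := exists_eq_smul_one_of_commute (q := q) V
  obtain ⟨ta, hta⟩ := schur _ (commute_aeval_self a _) (h.commute_aeval_chebyshevC hq0 hq2 hn)
    (h.commute_aeval_chebyshevC' hq0 hq2 hn)
  obtain ⟨tb, htb⟩ := schur _ (h.rotate.commute_aeval_chebyshevC' hq0 hq2 hn) (commute_aeval_self b _)
    (h.rotate.commute_aeval_chebyshevC hq0 hq2 hn)
  obtain ⟨tc, htc⟩ := schur _ (h.rotate.rotate.commute_aeval_chebyshevC hq0 hq2 hn)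
    (h.rotate.rotate.commute_aeval_chebyshevC' hq0 hq2 hn) (commute_aeval_self c _)
  obtain ⟨hwa, hwb, hwc⟩ := h.casimir_comm_s2 hq0
  obtain ⟨w, hw⟩ := schur _ hwa hwb hwc
  have hle := h.wordSpan_pow_le hq0 hw hta htb htc
  have hone := IsAWTriple_s2.one_le_wordSpan (𝔽 := 𝔽) a b c
  obtain ⟨ma, mb, mc⟩ := IsAWTriple_s2.wordSpan_gens (𝔽 := 𝔽) a b c
  have hmem : ∀ u : UAW 𝔽 q, ∃ N, uawRep 𝔽 q V u ∈ wordSpan 𝔽 a b c ^ N := by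
    intro u
    induction u using uaw_induction with
    | scalar r =>
      refine ⟨1, ?_⟩
      rw [AlgHom.commutes, pow_one, Algebra.algebraMap_eq_smul_one]
      exact IsAWTriple_s2.smul_one_mem_wordSpan a b c r
    | hA => exact ⟨1, by rwa [pow_one]⟩
    | hB => exact ⟨1, by rwa [pow_one]⟩
    | hC => exact ⟨1, by rwa [pow_one]⟩
    | add u v hu hv =>
      obtain ⟨M, hM⟩ := hu
      obtain ⟨N, hN⟩ := hv
      refine ⟨M + N, ?_⟩
      rw [map_add]
      exact add_mem (pow_le_pow_right₀ hone (Nat.le_add_right M N) hM)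
        (pow_le_pow_right₀ hone (Nat.le_add_left N M) hN)
    | mul u v hu hv =>
      obtain ⟨M, hM⟩ := hu
      obtain ⟨N, hN⟩ := hv
      refine ⟨M + N, ?_⟩
      rw [map_mul, pow_add]
      exact Submodule.mul_mem_mul hM hN
  have hfin := IsAWTriple_s2.finrank_span_monomials_le (𝔽 := 𝔽) a b c n
  rw [show Submodule.span 𝔽 {m : Module.End 𝔽 V | ∃ i j k, i < n + 1 ∧ j < n + 1 ∧ k < n + 1 ∧
      (i = 0 ∨ j = 0 ∨ k = 0) ∧ m = a ^ i * b ^ j * c ^ k} = ⊤ from ?_, finrank_top,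
    Module.finrank_linearMap] at hfin
  · apply Real.le_sqrt_of_sq_le
    have : ((Module.finrank 𝔽 V * Module.finrank 𝔽 V : ℕ) : ℝ) ≤
        ((3 * n ^ 2 + 3 * n + 1 : ℕ) : ℝ) :=
      Nat.cast_le.mpr hfin
    push_cast at this ⊢
    linarith
  · rw [eq_top_iff]
    rintro f -
    obtain ⟨u, rfl⟩ := uawRep_surjective (q := q) V f
    obtain ⟨N, hN⟩ := hmem u
    exact hle N hN
end
end

section
/- If {θ_i}_{i ∈ ℤ/đℤ} is a q-Racah sequence of type D, then the scalars θ_i for i ∈ ℤ/đℤ are mutually distinct. -/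
noncomputable section

/-- A `q`-Racah sequence of type `D`: `θ_i = a q^{−2i} + a⁻¹ q^{2i}` for some
nonzero `a ∈ 𝔽` with `a² ∉ {q^{2i} : i ∈ ℤ/đℤ}`. -/
def IsTypeD {𝔽 : Type*} [Field 𝔽] (q : 𝔽) {dd : ℕ} (θ : ZMod dd → 𝔽) : Prop :=
  ∃ a : 𝔽, a ≠ 0 ∧ (∀ i : ZMod dd, a ^ 2 ≠ q ^ (2 * i.val)) ∧
    ∀ i : ZMod dd, θ i = a * (q ^ (2 * i.val))⁻¹ + a⁻¹ * q ^ (2 * i.val)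

/-- The square of a primitive `d`-th root of unity is a primitive root of unity of order
`d` for odd `d` and `d / 2` for even `d`. -/
theorem IsPrimitiveRoot.sq_of_odd_or_even {M : Type*} [CommMonoid M] {d : ℕ} (hd : 0 < d)
    {q : M} (hq : IsPrimitiveRoot q d) :
    IsPrimitiveRoot (q ^ 2) (if Odd d then d else d / 2) := by
  split_ifs with h
  · exact hq.pow_of_coprime 2 h.coprime_two_left
  · obtain ⟨k, hk⟩ := (Nat.not_odd_iff_even.mp h).two_dvd
    exact hq.pow hd (by omega)

/-- The values of `x ↦ a x⁻¹ + a⁻¹ x` at `x` and `y` agree only if `x = y` or `a ^ 2 = x y`. -/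
theorem eq_or_sq_eq_mul_of_mul_inv_add_eq {K : Type*} [Field K] {a x y : K} (ha : a ≠ 0)
    (hx : x ≠ 0) (hy : y ≠ 0) (h : a * x⁻¹ + a⁻¹ * x = a * y⁻¹ + a⁻¹ * y) :
    x = y ∨ a ^ 2 = x * y := by
  field_simp at h
  have key : (x - y) * (a ^ 2 - x * y) = 0 := by linear_combination -h
  exact (mul_eq_zero.mp key).imp sub_eq_zero.mp sub_eq_zero.mp

/-- If `{θ_i}` is a `q`-Racah sequence of type `D`, then the scalars `θ_i`,
`i ∈ ℤ/đℤ`, are mutually distinct. -/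
theorem qRacah_typeD_injective {𝔽 : Type*} [Field 𝔽] [IsAlgClosed 𝔽]
    {d : ℕ} (hd : 0 < d) (hd1 : d ≠ 1) (hd2 : d ≠ 2) (hd4 : d ≠ 4)
    {q : 𝔽} (hq : IsPrimitiveRoot q d)
    (dd : ℕ) (hdd : dd = if Odd d then d else d / 2)
    (θ : ZMod dd → 𝔽) (hθ : IsTypeD q θ) :
    Function.Injective θ := by
  obtain ⟨a, ha, hne, hval⟩ := hθ
  have hq2 : IsPrimitiveRoot (q ^ 2) dd := hdd ▸ hq.sq_of_odd_or_even hd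
  have hdd0 : NeZero dd := ⟨by rw [hdd]; split_ifs <;> omega⟩
  have hq0 : q ≠ 0 := hq.ne_zero hd.ne'
  intro i j hij
  rw [hval, hval] at hij
  rcases eq_or_sq_eq_mul_of_mul_inv_add_eq ha (pow_ne_zero _ hq0) (pow_ne_zero _ hq0) hij
    with h | h
  · rw [pow_mul, pow_mul] at h
    exact ZMod.val_injective dd (hq2.pow_inj i.val_lt j.val_lt h)
  · refine absurd ?_ (hne (i + j))
    rw [h, pow_mul, pow_mul, pow_mul, ← pow_add, ZMod.val_add]
    exact pow_eq_pow_mod _ hq2.pow_eq_one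
end
end

section
/- If {θ_i}_{i ∈ ℤ/đℤ} is the q-Racah sequence of type E(q+q⁻¹), then for any i, j ∈ ℤ/đℤ one has θ_i = θ_j if and only if i ∈ {j, 1−j}. -/
noncomputable section

/-- The `q`-Racah sequence of type `E(q+q⁻¹)`: `đ` is even and
`θ_i = q^{2i−1} + q^{1−2i}`. -/
def IsTypeEq {𝔽 : Type*} [Field 𝔽] (q : 𝔽) {dd : ℕ} (θ : ZMod dd → 𝔽) : Prop :=
  Even dd ∧ ∀ i : ZMod dd, θ i = q ^ (2 * i.val) * q⁻¹ + q * (q ^ (2 * i.val))⁻¹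

/-- Powers of a primitive `k`-th root of unity agree exactly when the exponents agree mod `k`. -/
theorem IsPrimitiveRoot.pow_eq_pow_iff_natCast_zmod {M : Type*} [CommMonoid M] {p : M} {k : ℕ}
    (hp : IsPrimitiveRoot p k) (hk : 0 < k) (a b : ℕ) :
    p ^ a = p ^ b ↔ (a : ZMod k) = b := by
  have hfin : IsOfFinOrder p := isOfFinOrder_iff_pow_eq_one.2 ⟨k, hk, hp.pow_eq_one⟩
  rw [hfin.pow_eq_pow_iff_modEq, ← hp.eq_orderOf, ZMod.natCast_eq_natCast_iff]

/-- The values `x / q + q / x` and `y / q + q / y` agree exactly when `x = y` or `x * y = q ^ 2`. -/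
theorem mul_inv_add_mul_inv_eq_iff {K : Type*} [Field K] {q x y : K} (hq : q ≠ 0) (hx : x ≠ 0)
    (hy : y ≠ 0) :
    x * q⁻¹ + q * x⁻¹ = y * q⁻¹ + q * y⁻¹ ↔ x = y ∨ x * y = q ^ 2 := by
  have key : x * q⁻¹ + q * x⁻¹ - (y * q⁻¹ + q * y⁻¹) =
      (x - y) * (x * y - q ^ 2) * (x * y * q)⁻¹ := by
    field_simp
    ring
  rw [← sub_eq_zero, key, mul_eq_zero, mul_eq_zero, sub_eq_zero, sub_eq_zero,
    or_iff_left (inv_ne_zero (mul_ne_zero (mul_ne_zero hx hy) hq))]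

/-- If `{θ_i}` is the `q`-Racah sequence of type `E(q+q⁻¹)`, then for any
`i, j ∈ ℤ/đℤ` one has `θ_i = θ_j` if and only if `i ∈ {j, 1−j}`. -/
theorem qRacah_typeEq_eq_iff {𝔽 : Type*} [Field 𝔽] [IsAlgClosed 𝔽]
    {d : ℕ} (hd : 0 < d) (hd1 : d ≠ 1) (hd2 : d ≠ 2) (hd4 : d ≠ 4)
    {q : 𝔽} (hq : IsPrimitiveRoot q d)
    (dd : ℕ) (hdd : dd = if Odd d then d else d / 2)
    (θ : ZMod dd → 𝔽) (hθ : IsTypeEq q θ) :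
    ∀ i j : ZMod dd, θ i = θ j ↔ (i = j ∨ i = 1 - j) := by
  intro i j
  obtain ⟨hev, hθ⟩ := hθ
  have hodd : ¬ Odd d := by
    intro h
    rw [if_pos h] at hdd
    exact Nat.not_even_iff_odd.2 h (hdd ▸ hev)
  have hd2dd : d = 2 * dd := by
    have := Nat.not_odd_iff_even.1 hodd
    rw [if_neg hodd] at hdd
    grind
  have hpos : 0 < dd := by omega
  have : NeZero dd := ⟨hpos.ne'⟩
  have hp : IsPrimitiveRoot (q ^ 2) dd := hq.pow hd hd2dd
  have hq0 : q ≠ 0 := hq.ne_zero hd.ne'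
  rw [hθ, hθ, mul_inv_add_mul_inv_eq_iff hq0 (pow_ne_zero _ hq0) (pow_ne_zero _ hq0),
    pow_mul, pow_mul, ← pow_add, hp.pow_eq_pow_iff_natCast_zmod hpos]
  have hsum := hp.pow_eq_pow_iff_natCast_zmod hpos (i.val + j.val) 1
  rw [pow_one] at hsum
  rw [hsum]
  push_cast
  rw [ZMod.natCast_zmod_val, ZMod.natCast_zmod_val, eq_sub_iff_add_eq]
end
end
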